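/- Let G be a finite normal-form game with N ≥ 2 players all of whose pure-strategy payoffs G_n(s) are algebraic real numbers, and set κ = Σ_n |S_n|, d = N−1, Z = (2d+6)(2d+5)^{κ−1}, D = 5(κ(2d+4)+2)·Z, ℒ = d·(6d−3)^{2κ−1}, ℓ = 2d(ZD)^2(1+Z) and K = ℒ·ℓ. If σ ∈ Σ is a perfect equilibrium of G all of whose coordinates σ_n(s_n) are algebraic real numbers, then there exists an LPS profile ϱ of order K over S, all of whose probabilities ϱ_n^k(s_n) are algebraic real numbers, such that: (1) ϱ has full support and ℓ(ϱ) ≤ ℓ; (2) ϱ_n^0 = σ_n for each player n; (3) σ_n is a best reply of order K against ϱ for each player n. -/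

import Mathlib

namespace GamePE

variable {N : ℕ}

/-- A (not necessarily mixed) strategy profile. -/
abbrev Profile (S : Fin N → Type) := ∀ n, S n → ℝ

/-- τ is a profile of mixed strategies. -/
def IsMixed {S : Fin N → Type} [∀ n, Fintype (S n)] (τ : Profile S) : Prop :=
  ∀ n, (∀ s, 0 ≤ τ n s) ∧ (∑ s, τ n s) = 1

/-- τ is completely mixed. -/
def CompletelyMixed {S : Fin N → Type} (τ : Profile S) : Prop := ∀ n s, 0 < τ n s

/-- The pure strategy sn viewed as a mixed strategy. -/
def pureStrat {S : Fin N → Type} [∀ n, DecidableEq (S n)] {n : Fin N} (sn : S n) : S n → ℝ :=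
  fun s => if s = sn then 1 else 0

/-- The multilinear extension of player n's payoff. -/
noncomputable def payoff {S : Fin N → Type} [∀ n, Fintype (S n)]
    (G : Fin N → (∀ m, S m) → ℝ) (n : Fin N) (τ : Profile S) : ℝ :=
  ∑ s : ∀ m, S m, (∏ m, τ m (s m)) * G n s

/-- σ is a perfect equilibrium of the game G. -/
noncomputable def IsPerfect {S : Fin N → Type} [∀ n, Fintype (S n)] [∀ n, DecidableEq (S n)]
    (G : Fin N → (∀ m, S m) → ℝ) (σ : Profile S) : Prop :=
  ∃ σk : ℕ → Profile S,
    (∀ k, IsMixed (σk k) ∧ CompletelyMixed (σk k)) ∧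
    Filter.Tendsto σk Filter.atTop (nhds σ) ∧
    (∀ (k : ℕ) (n : Fin N) (sn : S n),
      payoff G n (Function.update (σk k) n (σ n)) ≥
        payoff G n (Function.update (σk k) n (pureStrat sn)))

/-- ϱ is an LPS profile of order K : each level of each player is a probability distribution. -/
def IsLPSProfile {S : Fin N → Type} [∀ n, Fintype (S n)] {K : ℕ}
    (ϱ : ∀ n, Fin (K+1) → S n → ℝ) : Prop :=
  ∀ n k, (∀ s, 0 ≤ ϱ n k s) ∧ (∑ s, ϱ n k s) = 1

/-- Full support for an LPS profile. -/
def FullSupport {S : Fin N → Type} {K : ℕ} (ϱ : ∀ n, Fin (K+1) → S n → ℝ) : Prop :=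
  ∀ n, ∀ s : S n, ∃ k, ϱ n k s ≠ 0

/-- ℓ(ϱ) : the max over the players of the first level at which the union of supports is everything. -/
noncomputable def lpsLevel {S : Fin N → Type} [∀ n, Fintype (S n)] {K : ℕ}
    (ϱ : ∀ n, Fin (K+1) → S n → ℝ) : ℕ :=
  Finset.univ.sup fun n =>
    sInf {k : ℕ | ∀ s : S n, ∃ i : Fin (K+1), (i : ℕ) ≤ k ∧ ϱ n i s ≠ 0}

/-- Combine a pure strategy of player n with a pure strategy profile of the others. -/
def combine {S : Fin N → Type} (n : Fin N) (sn : S n)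
    (so : ∀ m : {m : Fin N // m ≠ n}, S m.val) : ∀ m, S m :=
  fun m => if h : m = n then cast (congrArg S h.symm) sn else so ⟨m, h⟩

/-- Unnormalized induced beliefs of player n at level k. -/
noncomputable def ubelief {S : Fin N → Type} [∀ n, Fintype (S n)] {K : ℕ}
    (ϱ : ∀ n, Fin (K+1) → S n → ℝ) (n : Fin N) (k : ℕ)
    (so : ∀ m : {m : Fin N // m ≠ n}, S m.val) : ℝ :=
  ∑ kv ∈ Finset.univ.filter
      (fun kv : {m : Fin N // m ≠ n} → Fin (K+1) => (∑ m, ((kv m : ℕ))) = k),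
    ∏ m : {m : Fin N // m ≠ n}, ϱ m.val (kv m) (so m)

/-- Induced beliefs μ_n^k of player n at level k (normalized). -/
noncomputable def belief {S : Fin N → Type} [∀ n, Fintype (S n)] {K : ℕ}
    (ϱ : ∀ n, Fin (K+1) → S n → ℝ) (n : Fin N) (k : ℕ)
    (so : ∀ m : {m : Fin N // m ≠ n}, S m.val) : ℝ :=
  (∑ so' : ∀ m : {m : Fin N // m ≠ n}, S m.val, ubelief ϱ n k so')⁻¹ * ubelief ϱ n k so

/-- Expected payoff of player n playing τn against a belief μ over the opponents' profiles. -/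
noncomputable def beliefPayoff {S : Fin N → Type} [∀ n, Fintype (S n)]
    (G : Fin N → (∀ m, S m) → ℝ) (n : Fin N) (τn : S n → ℝ)
    (μ : (∀ m : {m : Fin N // m ≠ n}, S m.val) → ℝ) : ℝ :=
  ∑ so : ∀ m : {m : Fin N // m ≠ n}, S m.val, ∑ sn : S n,
    μ so * τn sn * G n (combine n sn so)

/-- Lexicographic comparison of the first k+1 entries (indices 0,…,k) of two sequences. -/
def lexGe (k : ℕ) (a b : ℕ → ℝ) : Prop :=
  (∀ i ≤ k, a i = b i) ∨ ∃ i ≤ k, (∀ j < i, a j = b j) ∧ b i < a i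

/-- τn is a best reply of order k against the LPS profile ϱ. -/
noncomputable def lpsBestReply {S : Fin N → Type} [∀ n, Fintype (S n)] [∀ n, DecidableEq (S n)]
    (G : Fin N → (∀ m, S m) → ℝ) {K : ℕ} (ϱ : ∀ n, Fin (K+1) → S n → ℝ)
    (n : Fin N) (τn : S n → ℝ) (k : ℕ) : Prop :=
  ∀ sn : S n,
    lexGe k (fun i => beliefPayoff G n τn (belief ϱ n i))
            (fun i => beliefPayoff G n (pureStrat sn) (belief ϱ n i))

/-- A polynomial strategy profile. -/
abbrev PolyProfile (S : Fin N → Type) := ∀ n, S n → Polynomial ℝ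

/-- f > 0 for a univariate real polynomial: the trailing (lowest-order) coefficient is positive. -/
def polyPos (f : Polynomial ℝ) : Prop := 0 < f.trailingCoeff

/-- f ≥ 0 : f is identically zero or its trailing coefficient is positive. -/
def polyNonneg (f : Polynomial ℝ) : Prop := f = 0 ∨ 0 < f.trailingCoeff

/-- The order o(η) of a polynomial strategy profile (∞ if some coordinate is zero). -/
noncomputable def polyOrder {S : Fin N → Type} [∀ n, Fintype (S n)]
    (η : PolyProfile S) : ℕ∞ :=
  Finset.univ.sup fun p : Σ n, S n => (η p.1 p.2).trailingDegree

/-- The polynomial t ↦ G_n(τn, η_{-n}(t)). -/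
noncomputable def payoffPoly {S : Fin N → Type} [∀ n, Fintype (S n)]
    (G : Fin N → (∀ m, S m) → ℝ) (η : PolyProfile S) (n : Fin N) (τn : S n → ℝ) :
    Polynomial ℝ :=
  ∑ s : ∀ m, S m,
    (Polynomial.C (τn (s n)) * ∏ m ∈ Finset.univ.erase n, η m (s m)) * Polynomial.C (G n s)

/-- τn is a best reply of order r against the polynomial strategy profile η. -/
noncomputable def polyBestReply {S : Fin N → Type} [∀ n, Fintype (S n)] [∀ n, DecidableEq (S n)]
    (G : Fin N → (∀ m, S m) → ℝ) (η : PolyProfile S) (n : Fin N) (τn : S n → ℝ) (r : ℕ) : Prop :=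
  ∀ sn : S n,
    polyNonneg (payoffPoly G η n τn - payoffPoly G η n (pureStrat sn)) ∨
    ((r + 1 : ℕ) : ℕ∞) ≤ (payoffPoly G η n τn - payoffPoly G η n (pureStrat sn)).trailingDegree

section CurveSelection

open Finset Filter Topology Hyperreal ArchimedeanClass

/-- If every `u (some i) ^ q` is a combination of monomials `T ^ a * u ^ c` of total degree at most
`q` and of degree less than `q` in `u`, then every monomial is a combination of monomials of no
greater degree in which all exponents of the `u (some i)` are less than `q`. -/
lemma monomial_mem_span_reduced {k B ι : Type*} [Field k] [CommRing B] [Algebra k B]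
    (q : ℕ) (T : B) (u : Option ι → B)
    (hred : ∀ i, u (some i) ^ q ∈ Submodule.span k
      {x : B | ∃ (a : ℕ) (c : Option ι →₀ ℕ), a + c.degree ≤ q ∧ c.degree < q ∧
        x = T ^ a * c.prod fun j e => u j ^ e})
    (n D a : ℕ) (c : Option ι →₀ ℕ) (hD : c.degree ≤ D) (hn : a + c.degree ≤ n) :
    T ^ a * (c.prod fun j e => u j ^ e) ∈ Submodule.span k
      {x : B | ∃ (a : ℕ) (c : Option ι →₀ ℕ), a + c.degree ≤ n ∧ (∀ i, c (some i) < q) ∧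
        x = T ^ a * c.prod fun j e => u j ^ e} := by
  classical
  induction D using Nat.strong_induction_on generalizing a c with
  | _ D ih =>
  by_cases hc : ∀ i, c (some i) < q
  · exact Submodule.subset_span ⟨a, c, hn, hc, rfl⟩
  push Not at hc
  obtain ⟨i, hi⟩ := hc
  set c' : Option ι →₀ ℕ := c - Finsupp.single (some i) q with hc'
  have hcc : c = c' + Finsupp.single (some i) q := by
    rw [hc', tsub_add_cancel_of_le]
    simpa using hi
  have hdeg : c.degree = c'.degree + q := by
    rw [hcc]; simp [map_add]
  have hprod : ∀ e : Option ι →₀ ℕ, (c' + e).prod (fun j e => u j ^ e)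
      = c'.prod (fun j e => u j ^ e) * e.prod (fun j e => u j ^ e) := fun e =>
    Finsupp.prod_add_index' (by simp) (by intros; rw [pow_add])
  have h1 : T ^ a * (c.prod fun j e => u j ^ e)
      = (T ^ a * c'.prod fun j e => u j ^ e) * u (some i) ^ q := by
    conv_lhs => rw [hcc]
    rw [hprod, Finsupp.prod_single_index (by simp), mul_assoc]
  rw [h1]
  suffices h : ∀ y ∈ Submodule.span k
      {x : B | ∃ (a : ℕ) (c : Option ι →₀ ℕ), a + c.degree ≤ q ∧ c.degree < q ∧
        x = T ^ a * c.prod fun j e => u j ^ e}, (T ^ a * c'.prod fun j e => u j ^ e) * y ∈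
      Submodule.span k
      {x : B | ∃ (a : ℕ) (c : Option ι →₀ ℕ), a + c.degree ≤ n ∧ (∀ i, c (some i) < q) ∧
        x = T ^ a * c.prod fun j e => u j ^ e} from h _ (hred i)
  intro y hy
  induction hy using Submodule.span_induction with
  | zero => simp
  | add x y _ _ hx hy => rw [mul_add]; exact add_mem hx hy
  | smul r x _ hx => rw [mul_smul_comm]; exact Submodule.smul_mem _ _ hx
  | mem x hx =>
    obtain ⟨a', e, h1, h2, rfl⟩ := hx
    have h3 : (T ^ a * c'.prod fun j e => u j ^ e) * (T ^ a' * e.prod fun j e => u j ^ e)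
        = T ^ (a + a') * (c' + e).prod fun j e => u j ^ e := by
      rw [hprod, pow_add]; ring
    rw [h3]
    have h4 : (c' + e).degree = c'.degree + e.degree := by simp [map_add]
    exact ih (c' + e).degree (by omega) _ _ le_rfl (by omega)

lemma card_le_of_linearIndependent_reduced {k B ι κ : Type*} [Field k] [CommRing B] [Algebra k B]
    [Fintype ι] [Fintype κ] (q : ℕ) (T : B) (u : Option ι → B)
    (hred : ∀ i, u (some i) ^ q ∈ Submodule.span k
      {x : B | ∃ (a : ℕ) (c : Option ι →₀ ℕ), a + c.degree ≤ q ∧ c.degree < q ∧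
        x = T ^ a * c.prod fun j e => u j ^ e})
    (n : ℕ) (v : κ → B) (hv : LinearIndependent k v)
    (hmem : ∀ j, v j ∈ Submodule.span k
      {x : B | ∃ (a : ℕ) (c : Option ι →₀ ℕ), a + c.degree ≤ n ∧
        x = T ^ a * c.prod fun j e => u j ^ e}) :
    Fintype.card κ ≤ (n + 1) ^ 2 * q ^ Fintype.card ι := by
  classical
  let X := Fin (n + 1) × Fin (n + 1) × (ι → Fin q)
  let g : X → B := fun x => T ^ (x.1 : ℕ) * ∏ j, u j ^ (j.elim (x.2.1 : ℕ) fun i => (x.2.2 i : ℕ))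
  have hle : Submodule.span k (Set.range v) ≤ Submodule.span k (Set.range g) := by
    rw [Submodule.span_le]
    rintro _ ⟨j, rfl⟩
    refine (Submodule.span_le.2 ?_) (hmem j)
    rintro _ ⟨a, c, hac, rfl⟩
    refine (Submodule.span_le.2 ?_)
      (monomial_mem_span_reduced q T u hred n _ a c le_rfl hac)
    rintro _ ⟨a, c, hac, hc, rfl⟩
    refine Submodule.subset_span ⟨(⟨a, by omega⟩, ⟨c none, ?_⟩, fun i => ⟨c (some i), hc i⟩), ?_⟩
    · have := Finsupp.le_degree none c
      omega
    · simp only [g]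
      rw [Finsupp.prod_fintype _ _ (by simp)]
      congr 1
      refine Finset.prod_congr rfl fun j _ => ?_
      cases j <;> rfl
  have h1 : Fintype.card κ = Module.finrank k (Submodule.span k (Set.range v)) :=
    (finrank_span_eq_card hv).symm
  have : FiniteDimensional k (Submodule.span k (Set.range g)) :=
    FiniteDimensional.span_of_finite k (Set.finite_range g)
  have h2 := Submodule.finrank_mono hle
  have h3 : (Set.range g).finrank k ≤ Fintype.card X := finrank_range_le_card g
  have h4 : Fintype.card X = (n + 1) ^ 2 * q ^ Fintype.card ι := by
    simp [X]; ring
  rw [Set.finrank] at h3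
  omega

lemma mul_aeval_mem_span {k B J : Type*} [Field k] [CommRing B] [Algebra k B] (b : B) (u : J → B)
    (Q : MvPolynomial J k) :
    b * MvPolynomial.aeval u Q ∈ Submodule.span k
      {x : B | ∃ c : J →₀ ℕ, c.degree ≤ Q.totalDegree ∧ x = b * c.prod fun j e => u j ^ e} := by
  have h : b * MvPolynomial.aeval u Q = ∑ c ∈ Q.support,
      b * MvPolynomial.aeval u (MvPolynomial.monomial c (Q.coeff c)) := by
    conv_lhs => rw [Q.as_sum, map_sum, Finset.mul_sum]
  rw [h]
  refine Submodule.sum_mem _ fun c hc => ?_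
  rw [MvPolynomial.aeval_monomial, ← Algebra.smul_def, mul_smul_comm]
  exact Submodule.smul_mem _ _ (Submodule.subset_span ⟨c, MvPolynomial.le_totalDegree hc, rfl⟩)

/-- Real functions multiplied by powers of a parameter tending to infinity stay linearly
independent if their limits are. -/
lemma coeff_eq_zero_of_tendsto {k κ : Type*} [Field k] [Algebra k ℝ] [Fintype κ]
    {U : Filter ℕ} [NeBot U] (hU : U ≤ atTop) (F : κ → ℕ → ℕ → ℝ) (F' : κ → ℕ → ℝ)
    (hF : ∀ l j, Tendsto (F l j) U (𝓝 (F' l j)))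
    (hind : ∀ g : κ → k, (∀ j, ∑ l, algebraMap k ℝ (g l) * F' l j = 0) → ∀ l, g l = 0)
    (m : ℕ) (g : ℕ → κ → k)
    (hg : ∀ j i : ℕ, ∑ a ∈ range m, ((i : ℝ) + 1) ^ a * ∑ l, algebraMap k ℝ (g a l) * F l j i = 0) :
    ∀ a < m, ∀ l, g a l = 0 := by
  induction m with
  | zero => intro a ha; omega
  | succ m ih =>
    have hT : Tendsto (fun i : ℕ => ((i : ℝ) + 1)⁻¹) U (𝓝 0) :=
      (tendsto_inv_atTop_zero.comp
        (tendsto_atTop_add_const_right _ _ tendsto_natCast_atTop_atTop)).mono_left hU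
    have hY : ∀ a j, Tendsto (fun i => ∑ l, algebraMap k ℝ (g a l) * F l j i) U
        (𝓝 (∑ l, algebraMap k ℝ (g a l) * F' l j)) := fun a j =>
      tendsto_finsetSum _ fun l _ => (hF l j).const_mul _
    have htop : ∀ l, g m l = 0 := by
      refine hind _ fun j => ?_
      refine tendsto_nhds_unique (hY m j) ?_
      have h1 : ∀ i : ℕ, ∑ l, algebraMap k ℝ (g m l) * F l j i
          = - ∑ a ∈ range m, (((i : ℝ) + 1)⁻¹) ^ (m - a) * ∑ l, algebraMap k ℝ (g a l) * F l j i := by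
        intro i
        have h2 := hg j i
        rw [sum_range_succ] at h2
        have h0 : ((i : ℝ) + 1) ≠ 0 := by positivity
        have h3 : ∑ a ∈ range m, (((i : ℝ) + 1)⁻¹) ^ (m - a)
              * ∑ l, algebraMap k ℝ (g a l) * F l j i
            = (((i : ℝ) + 1)⁻¹) ^ m * ∑ a ∈ range m, ((i : ℝ) + 1) ^ a
              * ∑ l, algebraMap k ℝ (g a l) * F l j i := by
          rw [mul_sum]
          refine sum_congr rfl fun a ha => ?_
          have ha' : a ≤ m := (mem_range.1 ha).le
          rw [← mul_assoc]
          congr 1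
          rw [inv_pow, inv_pow, eq_comm, inv_mul_eq_iff_eq_mul₀ (pow_ne_zero _ h0), eq_comm,
            mul_inv_eq_iff_eq_mul₀ (pow_ne_zero _ h0), ← pow_add]
          congr 1
          omega
        rw [h3, eq_neg_of_add_eq_zero_left h2, mul_neg, neg_neg, ← mul_assoc, inv_pow,
          inv_mul_cancel₀ (pow_ne_zero _ h0), one_mul]
      simp only [h1]
      have h4 : Tendsto (fun i : ℕ => - ∑ a ∈ range m, (((i : ℝ) + 1)⁻¹) ^ (m - a)
          * ∑ l, algebraMap k ℝ (g a l) * F l j i) U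
          (𝓝 (- ∑ a ∈ range m, (0 : ℝ) ^ (m - a) * ∑ l, algebraMap k ℝ (g a l) * F' l j)) :=
        (tendsto_finsetSum _ fun a _ => (hT.pow _).mul (hY a j)).neg
      convert h4 using 2
      rw [eq_comm, neg_eq_zero]
      refine sum_eq_zero fun a ha => ?_
      rw [zero_pow (Nat.sub_ne_zero_of_lt (mem_range.1 ha)), zero_mul]
    have hlow := ih (fun j i => by
      have := hg j i
      rw [sum_range_succ] at this
      simpa [htop] using this)
    intro a ha l
    rcases Nat.lt_succ_iff_lt_or_eq.1 ha with h | rfl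
    · exact hlow a h l
    · exact htop l

lemma ofSeq_aeval {k J : Type*} [Field k] [Algebra k ℝ] [Algebra k ℝ*]
    (hk : ∀ c : k, algebraMap k ℝ* c = ((algebraMap k ℝ c : ℝ) : ℝ*)) (x : ℕ → J → ℝ)
    (f : MvPolynomial J k) :
    MvPolynomial.aeval (fun o => ofSeq fun j => x j o) f
      = ofSeq fun j => MvPolynomial.aeval (x j) f := by
  induction f using MvPolynomial.induction_on with
  | C c => simp only [MvPolynomial.aeval_C, hk]; rfl
  | add p q hp hq => simp only [map_add, hp, hq]; rfl
  | mul_X p i hp => simp only [map_mul, hp, MvPolynomial.aeval_X]; rfl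

/-- The values at a limit of solutions of `u_i ^ q = T Q₁ + T² Q₂`, as `T` tends to infinity, of the
polynomials of degree at most `n` span a space of dimension linear in `n`. -/
lemma card_le_of_linearIndependent_aeval {k ι κ : Type*} [Field k] [Algebra k ℝ] [Algebra k ℝ*]
    (hk : ∀ c : k, algebraMap k ℝ* c = ((algebraMap k ℝ c : ℝ) : ℝ*))
    [Fintype ι] [Fintype κ] {U : Filter ℕ} [NeBot U] (hU : U ≤ atTop)
    (p : ℕ → ℕ → Option ι → ℝ) (p' : ℕ → Option ι → ℝ)
    (hp : ∀ j o, Tendsto (fun i => p j i o) U (𝓝 (p' j o)))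
    (q : ℕ) (Q₁ Q₂ : ι → MvPolynomial (Option ι) k)
    (hQ₁ : ∀ l, (Q₁ l).totalDegree + 2 ≤ q) (hQ₂ : ∀ l, (Q₂ l).totalDegree + 2 ≤ q)
    (heq : ∀ j i l, p j i (some l) ^ q = ((i : ℝ) + 1) * MvPolynomial.aeval (p j i) (Q₁ l)
      + ((i : ℝ) + 1) ^ 2 * MvPolynomial.aeval (p j i) (Q₂ l))
    (n : ℕ) (f : κ → MvPolynomial (Option ι) k) (hf : ∀ l, (f l).totalDegree ≤ n)
    (hind : LinearIndependent k
      fun l => MvPolynomial.aeval (fun o => ofSeq fun j => p' j o) (f l)) :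
    Fintype.card κ ≤ 4 * (n + 1) * q ^ Fintype.card ι := by
  classical
  let T : ℕ × ℕ → ℝ := fun x => (x.2 : ℝ) + 1
  let u : Option ι → ℕ × ℕ → ℝ := fun o x => p x.1 x.2 o
  have hu : ∀ (Q : MvPolynomial (Option ι) k) (x : ℕ × ℕ),
      MvPolynomial.aeval u Q x = MvPolynomial.aeval (p x.1 x.2) Q := by
    intro Q x
    induction Q using MvPolynomial.induction_on with
    | C c => simp
    | add p q hp hq => simp [hp, hq]
    | mul_X p i hp => simp [hp, u]
  have hred : ∀ l, u (some l) ^ q ∈ Submodule.span k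
      {x : ℕ × ℕ → ℝ | ∃ (a : ℕ) (c : Option ι →₀ ℕ), a + c.degree ≤ q ∧ c.degree < q ∧
        x = T ^ a * c.prod fun j e => u j ^ e} := by
    intro l
    have h1 : u (some l) ^ q = T ^ 1 * MvPolynomial.aeval u (Q₁ l)
        + T ^ 2 * MvPolynomial.aeval u (Q₂ l) := by
      ext x
      simp only [Pi.pow_apply, Pi.add_apply, Pi.mul_apply, hu]
      rw [heq, pow_one]
    rw [h1]
    refine add_mem ?_ ?_
    · refine Submodule.span_mono ?_ (mul_aeval_mem_span (T ^ 1) u (Q₁ l))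
      rintro _ ⟨c, hc, rfl⟩
      have := hQ₁ l
      exact ⟨1, c, by omega, by omega, rfl⟩
    · refine Submodule.span_mono ?_ (mul_aeval_mem_span (T ^ 2) u (Q₂ l))
      rintro _ ⟨c, hc, rfl⟩
      have := hQ₂ l
      exact ⟨2, c, by omega, by omega, rfl⟩
  have hcont : ∀ (Q : MvPolynomial (Option ι) k) j,
      Tendsto (fun i => MvPolynomial.aeval (p j i) Q) U (𝓝 (MvPolynomial.aeval (p' j) Q)) := by
    intro Q j
    induction Q using MvPolynomial.induction_on with
    | C c => simp
    | add p q hp hq => simpa using hp.add hq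
    | mul_X f i hf => simpa using hf.mul (hp j i)
  let v : Fin (n + 1) × κ → ℕ × ℕ → ℝ := fun x => T ^ (x.1 : ℕ) * MvPolynomial.aeval u (f x.2)
  have hv : LinearIndependent k v := by
    rw [Fintype.linearIndependent_iff]
    intro g hg
    have key := coeff_eq_zero_of_tendsto (k := k) hU (fun l j i => MvPolynomial.aeval (p j i) (f l))
      (fun l j => MvPolynomial.aeval (p' j) (f l)) (fun l j => hcont _ _) (fun c hc => by
        rw [Fintype.linearIndependent_iff] at hind
        refine hind c ?_
        have h1 : ∀ l, c l • MvPolynomial.aeval (fun o => ofSeq fun j => p' j o) (f l)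
            = MvPolynomial.aeval (fun o => ofSeq fun j => p' j o) (c l • f l) := fun l => by
          rw [map_smul]
        simp only [h1]
        rw [← map_sum, ofSeq_aeval hk]
        have h2 : (fun j => MvPolynomial.aeval (p' j) (∑ l, c l • f l)) = fun _ => (0 : ℝ) := by
          ext j
          rw [map_sum, ← hc j]
          simp [Algebra.smul_def]
        rw [h2]; rfl) (n + 1) (fun a l => if h : a < n + 1 then g (⟨a, h⟩, l) else 0) (fun j i => by
        have h1 := congrFun hg (j, i)
        rw [Fintype.sum_prod_type, Finset.sum_apply, Pi.zero_apply] at h1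
        rw [← h1, ← Fin.sum_univ_eq_sum_range]
        refine sum_congr rfl fun a _ => ?_
        rw [Finset.sum_apply, mul_sum]
        refine sum_congr rfl fun l _ => ?_
        rw [Pi.smul_apply, Algebra.smul_def, dif_pos a.2]
        simp only [v, T, Pi.mul_apply, Pi.pow_apply, hu, Fin.eta]
        ring)
    rintro ⟨a, l⟩
    have := key a a.2 l
    rwa [dif_pos a.2] at this
  have h2 := card_le_of_linearIndependent_reduced q T u hred (2 * n) v hv (by
    rintro ⟨a, l⟩
    refine Submodule.span_mono ?_ (mul_aeval_mem_span (T ^ (a : ℕ)) u (f l))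
    rintro _ ⟨c, hc, rfl⟩
    have := hf l
    have := a.2
    exact ⟨a, c, by omega, rfl⟩)
  rw [Fintype.card_prod, Fintype.card_fin] at h2
  have h3 : (n + 1) * Fintype.card κ ≤ (n + 1) * (4 * (n + 1) * q ^ Fintype.card ι) := by
    refine h2.trans ?_
    have h4 : (2 * n + 1) ^ 2 ≤ (n + 1) * (4 * (n + 1)) := by nlinarith
    calc _ ≤ ((n + 1) * (4 * (n + 1))) * q ^ Fintype.card ι := Nat.mul_le_mul_right _ h4
      _ = _ := by ring
  exact Nat.le_of_mul_le_mul_left h3 (Nat.succ_pos n)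

lemma exists_mk_sum_eq {κ : Type*} {s : Finset κ} (hs : s.Nonempty) (y : κ → ℝ*)
    (hinj : Set.InjOn (fun i => ArchimedeanClass.mk (y i)) s) :
    ∃ i ∈ s, ArchimedeanClass.mk (∑ i ∈ s, y i) = ArchimedeanClass.mk (y i) := by
  induction hs using Finset.Nonempty.cons_induction with
  | singleton a => exact ⟨a, by simp⟩
  | cons a s ha hs ih =>
    obtain ⟨i, hi, h⟩ := ih (hinj.mono (by simp))
    rw [sum_cons]
    have hne : ArchimedeanClass.mk (y a) ≠ ArchimedeanClass.mk (y i) := fun h' =>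
      ha (hinj (by simp) (by simp [hi]) h' ▸ hi)
    rw [← h] at hne
    rcases lt_or_gt_of_ne hne with h' | h'
    · exact ⟨a, by simp, mk_add_eq_mk_left h'⟩
    · exact ⟨i, by simp [hi], (mk_add_eq_mk_right h').trans h⟩

lemma sum_ne_zero_of_injOn_mk {κ : Type*} {s : Finset κ} (hs : s.Nonempty) (y : κ → ℝ*)
    (h0 : ∀ i ∈ s, y i ≠ 0) (hinj : Set.InjOn (fun i => ArchimedeanClass.mk (y i)) s) :
    ∑ i ∈ s, y i ≠ 0 := by
  obtain ⟨i, hi, h⟩ := exists_mk_sum_eq hs y hinj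
  intro h'
  rw [h', ArchimedeanClass.mk_zero] at h
  exact h0 i hi (ArchimedeanClass.mk_eq_top_iff.1 h.symm)

lemma nsmul_mk_lt_nsmul_mk {x : ℝ*} (hx : 0 < ArchimedeanClass.mk x) (hx0 : x ≠ 0) {a b : ℕ}
    (h : a < b) : a • ArchimedeanClass.mk x < b • ArchimedeanClass.mk x := by
  have h1 : 0 < ArchimedeanClass.mk (x ^ (b - a)) := by
    rw [mk_pow]
    exact nsmul_pos hx (by omega)
  have h2 : ArchimedeanClass.mk (x ^ b) = ArchimedeanClass.mk (x ^ a)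
      + ArchimedeanClass.mk (x ^ (b - a)) := by
    rw [← mk_mul, ← pow_add]; congr 2; omega
  rw [← mk_pow, ← mk_pow]
  refine lt_of_le_of_ne (by rw [h2]; exact le_add_of_nonneg_right h1.le) fun h3 => ?_
  rw [h2] at h3
  have hne : ArchimedeanClass.mk (x ^ a) ≠ ⊤ := by
    rw [Ne, ArchimedeanClass.mk_eq_top_iff]
    exact pow_ne_zero _ hx0
  exact h1.ne (add_left_cancel_of_ne_top hne ((add_zero _).trans h3))

section Growth

variable {k J : Type*} [Field k] [Algebra k ℝ] [Algebra k ℝ*]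

lemma mk_algebraMap_of_ne_zero (hk : ∀ c : k, algebraMap k ℝ* c = ((algebraMap k ℝ c : ℝ) : ℝ*))
    {c : k} (hc : c ≠ 0) : ArchimedeanClass.mk (algebraMap k ℝ* c) = 0 := by
  rw [hk]
  exact archimdeanClassMk_coe (by simpa using hc)

lemma linearIndependent_of_injective_mk
    (hk : ∀ c : k, algebraMap k ℝ* c = ((algebraMap k ℝ c : ℝ) : ℝ*)) {κ : Type*} (v : κ → ℝ*)
    (h0 : ∀ i, v i ≠ 0) (hinj : Function.Injective fun i => ArchimedeanClass.mk (v i)) :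
    LinearIndependent k v := by
  classical
  rw [linearIndependent_iff']
  intro s g hg i hi
  by_contra hne
  have h1 : ∑ i ∈ s.filter (fun i => g i ≠ 0), g i • v i = 0 := by
    rw [sum_filter_of_ne, hg]
    intro j _ h h'
    simp [h'] at h
  refine sum_ne_zero_of_injOn_mk ⟨i, by simp [hi, hne]⟩ _ ?_ ?_ h1
  · intro j hj
    exact smul_ne_zero (by simpa using (mem_filter.1 hj).2) (h0 j)
  · have h2 : ∀ j ∈ s.filter (fun i => g i ≠ 0),
        ArchimedeanClass.mk (g j • v j) = ArchimedeanClass.mk (v j) := fun j hj => by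
      rw [Algebra.smul_def, mk_mul, mk_algebraMap_of_ne_zero hk (mem_filter.1 hj).2, zero_add]
    intro a ha b hb hab
    simp only [h2 a ha, h2 b hb] at hab
    exact hinj hab

lemma card_le_of_mk_lt (hk : ∀ c : k, algebraMap k ℝ* c = ((algebraMap k ℝ c : ℝ) : ℝ*))
    (u : J → ℝ*) (C : ℕ)
    (hgrow : ∀ (n : ℕ) (κ : Type) [Fintype κ] (f : κ → MvPolynomial J k),
      (∀ l, (f l).totalDegree ≤ n) → LinearIndependent k (fun l => MvPolynomial.aeval u (f l)) →
      Fintype.card κ ≤ C * (n + 1))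
    (g : MvPolynomial J k) (hg0 : MvPolynomial.aeval u g ≠ 0)
    (r : ℕ) (v : Fin r → ℝ*) (hvE : ∀ j, v j ∈ IntermediateField.adjoin k (Set.range u))
    (hv : ∀ j, 0 ≤ ArchimedeanClass.mk (v j))
    (hvg : ∀ j, ArchimedeanClass.mk (v j) < ArchimedeanClass.mk (MvPolynomial.aeval u g))
    (hinj : Function.Injective fun j => ArchimedeanClass.mk (v j)) :
    r ≤ C * g.totalDegree := by
  classical
  set x := MvPolynomial.aeval u g with hx
  set e := g.totalDegree
  have hv0 : ∀ j, v j ≠ 0 := fun j h => by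
    have := hvg j
    rw [h, ArchimedeanClass.mk_zero] at this
    exact not_top_lt this
  simp only [IntermediateField.mem_adjoin_range_iff] at hvE
  choose a b hab using hvE
  have hb0 : ∀ j, MvPolynomial.aeval u (b j) ≠ 0 := fun j h => by
    apply hv0 j; rw [hab, h, div_zero]
  let G : MvPolynomial J k := ∏ j, b j
  let f : Fin r → MvPolynomial J k := fun j => a j * ∏ i ∈ univ.erase j, b i
  have hG0 : MvPolynomial.aeval u G ≠ 0 := by
    simp only [G, map_prod]
    exact prod_ne_zero_iff.2 fun j _ => hb0 j
  have hf : ∀ j, MvPolynomial.aeval u (f j) = v j * MvPolynomial.aeval u G := by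
    intro j
    simp only [f, G, map_mul, map_prod]
    rw [← mul_prod_erase univ _ (mem_univ j), hab]
    field_simp [hb0 j]
  let N := univ.sup fun j => (f j).totalDegree
  have key : ∀ n : ℕ, (n + 1) * r ≤ C * (n * e + N + 1) := by
    intro n
    have := hgrow (n * e + N) (Fin (n + 1) × Fin r) (fun ij => g ^ (ij.1 : ℕ) * f ij.2) (by
      rintro ⟨i, j⟩
      refine (MvPolynomial.totalDegree_mul _ _).trans (Nat.add_le_add ?_ ?_)
      · refine (MvPolynomial.totalDegree_pow _ _).trans (Nat.mul_le_mul_right _ ?_)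
        have := i.2
        omega
      · exact le_sup (f := fun j => (f j).totalDegree) (mem_univ j)) (by
      refine linearIndependent_of_injective_mk hk _ ?_ ?_
      · rintro ⟨i, j⟩
        simp only [map_mul, map_pow, hf]
        exact mul_ne_zero (pow_ne_zero _ hg0) (mul_ne_zero (hv0 j) hG0)
      · have hne : ∀ i : Fin (n + 1),
            ArchimedeanClass.mk (x ^ (i : ℕ) * MvPolynomial.aeval u G) ≠ ⊤ := fun i => by
          rw [Ne, ArchimedeanClass.mk_eq_top_iff]
          exact mul_ne_zero (pow_ne_zero _ hg0) hG0
        have main : ∀ (i i' : Fin (n + 1)) (j j' : Fin r), (i : ℕ) < i' →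
            ArchimedeanClass.mk (x ^ (i : ℕ) * (v j * MvPolynomial.aeval u G)) ≠
            ArchimedeanClass.mk (x ^ (i' : ℕ) * (v j' * MvPolynomial.aeval u G)) := by
          intro i i' j j' hii h
          have h1 : x ^ (i' : ℕ) * (v j' * MvPolynomial.aeval u G)
              = (x ^ (i : ℕ) * MvPolynomial.aeval u G) * (x * (x ^ ((i' : ℕ) - i - 1) * v j')) := by
            have : (i' : ℕ) = i + 1 + (i' - i - 1) := by omega
            conv_lhs => rw [this, pow_add, pow_add]
            ring
          have h2 : x ^ (i : ℕ) * (v j * MvPolynomial.aeval u G)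
              = (x ^ (i : ℕ) * MvPolynomial.aeval u G) * v j := by ring
          rw [h1, h2, mk_mul _ (v j), mk_mul _ (x * _)] at h
          have h3 := add_left_cancel_of_ne_top (hne i) h
          rw [mk_mul, mk_mul, mk_pow] at h3
          have h4 := hvg j
          rw [h3] at h4
          have h5 : 0 ≤ ArchimedeanClass.mk x := (hv j).trans (hvg j).le
          have h6 : 0 ≤ ((i' : ℕ) - i - 1) • ArchimedeanClass.mk x + ArchimedeanClass.mk (v j') :=
            add_nonneg (nsmul_nonneg h5 _) (hv j')
          exact h4.not_ge (le_add_of_nonneg_right h6)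
        rintro ⟨i, j⟩ ⟨i', j'⟩ h
        simp only [map_mul, map_pow, hf, ← hx] at h
        rcases lt_trichotomy (i : ℕ) i' with h1 | h1 | h1
        · exact absurd h (main _ _ _ _ h1)
        · have h2 : i = i' := Fin.ext h1
          subst h2
          have h1 : ∀ j, x ^ (i : ℕ) * (v j * MvPolynomial.aeval u G)
              = (x ^ (i : ℕ) * MvPolynomial.aeval u G) * v j := fun j => by ring
          rw [h1, h1, mk_mul, mk_mul _ (v j')] at h
          have h3 := add_left_cancel_of_ne_top (hne i) h
          rw [hinj h3]
        · exact absurd h.symm (main _ _ _ _ h1))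
    rw [Fintype.card_prod, Fintype.card_fin, Fintype.card_fin] at this
    exact this
  by_contra hlt
  push Not at hlt
  have h1 := key (C * (N + 1))
  nlinarith [Nat.mul_le_mul_left (C * (N + 1) + 1) hlt]

/-- Linear growth makes the valuation on the generated field discrete. -/
lemma exists_uniformizer (hk : ∀ c : k, algebraMap k ℝ* c = ((algebraMap k ℝ c : ℝ) : ℝ*))
    (u : J → ℝ*) (C : ℕ)
    (hgrow : ∀ (n : ℕ) (κ : Type) [Fintype κ] (f : κ → MvPolynomial J k),
      (∀ l, (f l).totalDegree ≤ n) → LinearIndependent k (fun l => MvPolynomial.aeval u (f l)) →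
      Fintype.card κ ≤ C * (n + 1))
    (g : MvPolynomial J k) (hg0 : MvPolynomial.aeval u g ≠ 0)
    (hg : 0 < ArchimedeanClass.mk (MvPolynomial.aeval u g)) :
    ∃ t ∈ IntermediateField.adjoin k (Set.range u), 0 < t ∧ 0 < ArchimedeanClass.mk t ∧
      ∀ y ∈ IntermediateField.adjoin k (Set.range u), 0 < ArchimedeanClass.mk y →
        ArchimedeanClass.mk t ≤ ArchimedeanClass.mk y := by
  set E := IntermediateField.adjoin k (Set.range u)
  have hgE : MvPolynomial.aeval u g ∈ E :=
    (IntermediateField.mem_adjoin_range_iff _ _ _).2 ⟨g, 1, by simp⟩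
  suffices h : ∃ t ∈ E, t ≠ 0 ∧ 0 < ArchimedeanClass.mk t ∧
      ∀ y ∈ E, 0 < ArchimedeanClass.mk y → ArchimedeanClass.mk t ≤ ArchimedeanClass.mk y by
    obtain ⟨t, h1, h2, h3, h4⟩ := h
    refine ⟨|t|, ?_, abs_pos.2 h2, by rwa [mk_abs], by simpa only [mk_abs] using h4⟩
    rcases abs_choice t with h | h <;> rw [h]
    · exact h1
    · exact neg_mem h1
  by_contra! hcon
  have hstep : ∀ y : {y : ℝ* // y ∈ E ∧ y ≠ 0 ∧ 0 < ArchimedeanClass.mk y},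
      ∃ z : {y : ℝ* // y ∈ E ∧ y ≠ 0 ∧ 0 < ArchimedeanClass.mk y},
      ArchimedeanClass.mk z.1 < ArchimedeanClass.mk y.1 := by
    rintro ⟨y, h1, h2, h3⟩
    obtain ⟨z, h4, h5, h6⟩ := hcon y h1 h2 h3
    exact ⟨⟨z, h4, fun h => by
      rw [h, ArchimedeanClass.mk_zero] at h6
      exact not_top_lt h6, h5⟩, h6⟩
  choose nxt hnxt using hstep
  obtain ⟨s, hs0, hs1⟩ : ∃ s : ℕ → {y : ℝ* // y ∈ E ∧ y ≠ 0 ∧ 0 < ArchimedeanClass.mk y},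
      (s 0).1 = MvPolynomial.aeval u g ∧ ∀ n, s (n + 1) = nxt (s n) :=
    ⟨fun n => nxt^[n] ⟨_, hgE, hg0, hg⟩, rfl, fun n => Function.iterate_succ_apply' _ _ _⟩
  have hs : StrictAnti fun n => ArchimedeanClass.mk (s n).1 := by
    refine strictAnti_nat_of_succ_lt fun n => ?_
    rw [hs1]
    exact hnxt _
  have hlt : ∀ j : ℕ, ArchimedeanClass.mk (s (j + 1)).1
      < ArchimedeanClass.mk (MvPolynomial.aeval u g) := fun j => by
    rw [← hs0]
    exact hs (Nat.succ_pos j)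
  have := card_le_of_mk_lt hk u C hgrow g hg0 (C * g.totalDegree + 1) (fun j => (s (j + 1)).1)
    (fun j => (s _).2.1) (fun j => (s _).2.2.2.le) (fun j => hlt j)
    (fun i j h => by
      have h' : (i : ℕ) + 1 = j + 1 := hs.injective h
      exact Fin.ext (by omega))
  omega

lemma exists_mk_eq_nsmul (hk : ∀ c : k, algebraMap k ℝ* c = ((algebraMap k ℝ c : ℝ) : ℝ*))
    (u : J → ℝ*) (C : ℕ)
    (hgrow : ∀ (n : ℕ) (κ : Type) [Fintype κ] (f : κ → MvPolynomial J k),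
      (∀ l, (f l).totalDegree ≤ n) → LinearIndependent k (fun l => MvPolynomial.aeval u (f l)) →
      Fintype.card κ ≤ C * (n + 1))
    (g : MvPolynomial J k) (hg0 : MvPolynomial.aeval u g ≠ 0)
    (hg : 0 < ArchimedeanClass.mk (MvPolynomial.aeval u g))
    (t : ℝ*) (htE : t ∈ IntermediateField.adjoin k (Set.range u)) (ht0 : t ≠ 0)
    (htpos : 0 < ArchimedeanClass.mk t)
    (ht : ∀ y ∈ IntermediateField.adjoin k (Set.range u), 0 < ArchimedeanClass.mk y →
        ArchimedeanClass.mk t ≤ ArchimedeanClass.mk y) :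
    ∃ m ≤ C * g.totalDegree,
      ArchimedeanClass.mk (MvPolynomial.aeval u g) = m • ArchimedeanClass.mk t := by
  classical
  set x := MvPolynomial.aeval u g with hx
  have hgE : x ∈ IntermediateField.adjoin k (Set.range u) :=
    (IntermediateField.mem_adjoin_range_iff _ _ _).2 ⟨g, 1, by simp [hx]⟩
  have hex : ∃ m, m ≤ C * g.totalDegree ∧ ArchimedeanClass.mk x ≤ m • ArchimedeanClass.mk t := by
    by_contra! hcon
    have := card_le_of_mk_lt hk u C hgrow g hg0 (C * g.totalDegree + 1) (fun j => t ^ (j : ℕ))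
      (fun j => pow_mem htE _) (fun j => by rw [mk_pow]; exact nsmul_nonneg htpos.le _)
      (fun j => by rw [mk_pow]; exact hcon j (by omega))
      (fun i j h => by
        by_contra hne
        rcases lt_or_gt_of_ne hne with h1 | h1
        · exact (nsmul_mk_lt_nsmul_mk htpos ht0 h1).ne h
        · exact (nsmul_mk_lt_nsmul_mk htpos ht0 h1).ne h.symm)
    omega
  obtain ⟨hm1, hm2⟩ := Nat.find_spec hex
  set m := Nat.find hex with hm
  refine ⟨m, hm1, le_antisymm hm2 ?_⟩
  obtain ⟨m', hm'⟩ : ∃ m', m = m' + 1 := by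
    refine Nat.exists_eq_succ_of_ne_zero fun h => ?_
    rw [h, zero_smul] at hm2
    exact hg.not_ge hm2
  have hlt : m' • ArchimedeanClass.mk t < ArchimedeanClass.mk x := by
    by_contra hle
    have := Nat.find_min hex (m := m') (by omega)
    exact this ⟨by omega, not_lt.1 hle⟩
  have hxy : x = x / t ^ m' * t ^ m' := by
    rw [div_mul_cancel₀ _ (pow_ne_zero _ ht0)]
  have hmk : ArchimedeanClass.mk x = ArchimedeanClass.mk (x / t ^ m') + m' • ArchimedeanClass.mk t := by
    conv_lhs => rw [hxy]
    rw [mk_mul, mk_pow]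
  have hpos : 0 < ArchimedeanClass.mk (x / t ^ m') := by
    by_contra hle
    rw [hmk] at hlt
    exact hlt.not_ge (add_le_of_nonpos_left (not_lt.1 hle))
  have := ht _ (div_mem hgE (pow_mem htE _)) hpos
  rw [hm', succ_nsmul', hmk]
  exact add_le_add_left this _

lemma mk_nonneg_and_stdPart_aeval
    (hk : ∀ c : k, algebraMap k ℝ* c = ((algebraMap k ℝ c : ℝ) : ℝ*)) {y : ℝ*}
    (hy : 0 ≤ ArchimedeanClass.mk y) (p : Polynomial k) :
    0 ≤ ArchimedeanClass.mk (Polynomial.aeval y p) ∧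
      stdPart (Polynomial.aeval y p) = Polynomial.aeval (stdPart y) p := by
  induction p using Polynomial.induction_on with
  | C c =>
    simp only [Polynomial.aeval_C, hk]
    exact ⟨archimedeanClassMk_coe_nonneg _, stdPart_coe _⟩
  | add p q hp hq =>
    rw [map_add, map_add, stdPart_add hp.1 hq.1, hp.2, hq.2]
    exact ⟨(le_min hp.1 hq.1).trans (min_le_mk_add _ _), rfl⟩
  | monomial n c h =>
    rw [pow_succ, ← mul_assoc, map_mul, map_mul _ _ Polynomial.X, stdPart_mul h.1 (by simpa),
      h.2, mk_mul]
    simp only [Polynomial.aeval_X]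
    exact ⟨add_nonneg h.1 hy, trivial⟩

/-- Linear growth makes the residue field of the generated field algebraic. -/
lemma isAlgebraic_stdPart (hk : ∀ c : k, algebraMap k ℝ* c = ((algebraMap k ℝ c : ℝ) : ℝ*))
    (u : J → ℝ*) (C : ℕ)
    (hgrow : ∀ (n : ℕ) (κ : Type) [Fintype κ] (f : κ → MvPolynomial J k),
      (∀ l, (f l).totalDegree ≤ n) → LinearIndependent k (fun l => MvPolynomial.aeval u (f l)) →
      Fintype.card κ ≤ C * (n + 1))
    (g : MvPolynomial J k) (hg0 : MvPolynomial.aeval u g ≠ 0)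
    (hg : 0 < ArchimedeanClass.mk (MvPolynomial.aeval u g))
    (y : ℝ*) (hyE : y ∈ IntermediateField.adjoin k (Set.range u))
    (hy : 0 ≤ ArchimedeanClass.mk y) : IsAlgebraic k (stdPart y) := by
  classical
  by_contra htr
  rw [IntermediateField.mem_adjoin_range_iff] at hyE
  obtain ⟨a, b, hab⟩ := hyE
  have hb0 : MvPolynomial.aeval u b ≠ 0 := by
    intro h
    apply htr
    rw [hab, h, div_zero, stdPart_zero]
    exact isAlgebraic_zero
  set D := a.totalDegree + b.totalDegree + g.totalDegree with hD
  set n := C * (D + 1) with hn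
  have hval : ∀ (i j : ℕ), i ≤ n → MvPolynomial.aeval u (a ^ i * b ^ (n - i) * g ^ j)
      = MvPolynomial.aeval u b ^ n * (MvPolynomial.aeval u g ^ j * y ^ i) := by
    intro i j hi
    have : MvPolynomial.aeval u b ^ n
        = MvPolynomial.aeval u b ^ i * MvPolynomial.aeval u b ^ (n - i) := by
      rw [← pow_add]; congr 1; omega
    rw [map_mul, map_mul, map_pow, map_pow, map_pow, this, hab]
    rw [div_pow]
    field_simp [hb0]
  have := hgrow (D * n) (Fin (n + 1) × Fin (n + 1))
    (fun ij => a ^ (ij.1 : ℕ) * b ^ (n - ij.1) * g ^ (ij.2 : ℕ)) (by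
      rintro ⟨i, j⟩
      have h1 := MvPolynomial.totalDegree_pow a (i : ℕ)
      have h2 := MvPolynomial.totalDegree_pow b (n - i)
      have h3 := MvPolynomial.totalDegree_pow g (j : ℕ)
      have h4 := MvPolynomial.totalDegree_mul (a ^ (i : ℕ)) (b ^ (n - i))
      have h5 := MvPolynomial.totalDegree_mul (a ^ (i : ℕ) * b ^ (n - i)) (g ^ (j : ℕ))
      have h6 : (i : ℕ) * a.totalDegree ≤ n * a.totalDegree := Nat.mul_le_mul_right _ (by omega)
      have h7 : (n - i : ℕ) * b.totalDegree ≤ n * b.totalDegree :=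
        Nat.mul_le_mul_right _ (by omega)
      have h8 : (j : ℕ) * g.totalDegree ≤ n * g.totalDegree := Nat.mul_le_mul_right _ (by omega)
      have h9 : D * n = n * a.totalDegree + n * b.totalDegree + n * g.totalDegree := by
        rw [hD]; ring
      simp only
      omega) (by
      rw [Fintype.linearIndependent_iff]
      intro c hc
      by_contra! hne
      obtain ⟨⟨i₀, j₀⟩, hne⟩ := hne
      let p : Fin (n + 1) → Polynomial k := fun j =>
        ∑ i : Fin (n + 1), Polynomial.monomial (i : ℕ) (c (i, j))
      have hp : ∀ i j, (p j).coeff (i : Fin (n + 1)) = c (i, j) := by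
        intro i j
        simp only [p, Polynomial.finsetSum_coeff, Polynomial.coeff_monomial, Fin.val_inj]
        simp
      have hpy : ∀ j, Polynomial.aeval y (p j) = ∑ i, c (i, j) • y ^ (i : ℕ) := by
        intro j
        simp [p, Polynomial.aeval_monomial, Algebra.smul_def]
      have hsum : ∑ j : Fin (n + 1), MvPolynomial.aeval u g ^ (j : ℕ) * Polynomial.aeval y (p j)
          = 0 := by
        have h1 : MvPolynomial.aeval u b ^ n * ∑ j : Fin (n + 1),
            MvPolynomial.aeval u g ^ (j : ℕ) * Polynomial.aeval y (p j) = 0 := by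
          rw [← hc, Fintype.sum_prod_type_right, mul_sum]
          refine sum_congr rfl fun j _ => ?_
          rw [hpy, mul_sum, mul_sum]
          refine sum_congr rfl fun i _ => ?_
          rw [hval _ _ (by omega), mul_smul_comm, mul_smul_comm]
        exact (mul_eq_zero.1 h1).resolve_left (pow_ne_zero _ hb0)
      let s := univ.filter fun j => p j ≠ 0
      have hmk : ∀ j ∈ s, ArchimedeanClass.mk (Polynomial.aeval y (p j)) = 0 := by
        intro j hj
        by_contra h
        rw [← Ne, ← stdPart_eq_zero, (mk_nonneg_and_stdPart_aeval hk hy _).2] at h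
        exact htr ⟨p j, (mem_filter.1 hj).2, h⟩
      have hmk' : ∀ j ∈ s, ArchimedeanClass.mk (MvPolynomial.aeval u g ^ (j : ℕ)
          * Polynomial.aeval y (p j)) = (j : ℕ) • ArchimedeanClass.mk (MvPolynomial.aeval u g) := by
        intro j hj
        rw [mk_mul, hmk j hj, add_zero, mk_pow]
      refine sum_ne_zero_of_injOn_mk (s := s) ⟨j₀, ?_⟩ (fun j => MvPolynomial.aeval u g ^ (j : ℕ)
        * Polynomial.aeval y (p j)) ?_ ?_ ?_
      · refine mem_filter.2 ⟨mem_univ _, fun h => hne ?_⟩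
        rw [← hp, h, Polynomial.coeff_zero]
      · intro j hj
        refine mul_ne_zero (pow_ne_zero _ hg0) fun h => ?_
        have := hmk j hj
        rw [h, ArchimedeanClass.mk_zero] at this
        exact top_ne_zero this
      · intro i hi j hj h
        simp only [hmk' i hi, hmk' j hj] at h
        by_contra hne
        rcases lt_or_gt_of_ne hne with h1 | h1
        · exact (nsmul_mk_lt_nsmul_mk hg hg0 h1).ne h
        · exact (nsmul_mk_lt_nsmul_mk hg hg0 h1).ne h.symm
      · rw [sum_filter_of_ne, hsum]
        intro j _ h h'
        simp [h'] at h)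
  rw [Fintype.card_prod, Fintype.card_fin] at this
  nlinarith [Nat.zero_le (C * n), Nat.zero_le (C * D)]

end Growth

section Expansion

variable {k : Type*} [Field k] [Algebra k ℝ*]

/-- The hyperreal `x` has the asymptotic expansion `a` in powers of the infinitesimal `t`. -/
def HasExpansion (t x : ℝ*) (a : PowerSeries k) : Prop :=
  ∀ n : ℕ, ∃ p : Polynomial k, (PowerSeries.X ^ n : PowerSeries k) ∣ a - p ∧
    n • ArchimedeanClass.mk t ≤ ArchimedeanClass.mk (x - Polynomial.aeval t p)

lemma hasExpansion_C (t : ℝ*) (c : k) :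
    HasExpansion t (algebraMap k ℝ* c) (PowerSeries.C c) := fun n =>
  ⟨Polynomial.C c, by simp, by simp⟩

lemma HasExpansion.add {t x y : ℝ*} {a b : PowerSeries k} (hx : HasExpansion t x a)
    (hy : HasExpansion t y b) : HasExpansion t (x + y) (a + b) := fun n => by
  obtain ⟨p, h1, h2⟩ := hx n
  obtain ⟨q, h3, h4⟩ := hy n
  refine ⟨p + q, ?_, ?_⟩
  · rw [Polynomial.coe_add, add_sub_add_comm]
    exact dvd_add h1 h3
  · rw [map_add, add_sub_add_comm]
    exact (le_min h2 h4).trans (min_le_mk_add _ _)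

variable [Algebra k ℝ]

lemma HasExpansion.finite {t x : ℝ*} {a : PowerSeries k}
    (hk : ∀ c : k, algebraMap k ℝ* c = ((algebraMap k ℝ c : ℝ) : ℝ*))
    (ht : 0 < ArchimedeanClass.mk t) (hx : HasExpansion t x a) : 0 ≤ ArchimedeanClass.mk x := by
  obtain ⟨p, -, h2⟩ := hx 0
  rw [zero_smul] at h2
  have := (le_min h2 (mk_nonneg_and_stdPart_aeval hk ht.le p).1).trans (min_le_mk_add _ _)
  simpa using this

lemma HasExpansion.mul {t x y : ℝ*} {a b : PowerSeries k}
    (hk : ∀ c : k, algebraMap k ℝ* c = ((algebraMap k ℝ c : ℝ) : ℝ*))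
    (ht : 0 < ArchimedeanClass.mk t) (hx : HasExpansion t x a)
    (hy : HasExpansion t y b) : HasExpansion t (x * y) (a * b) := fun n => by
  obtain ⟨p, h1, h2⟩ := hx n
  obtain ⟨q, h3, h4⟩ := hy n
  refine ⟨p * q, ?_, ?_⟩
  · have : a * b - ((p * q : Polynomial k) : PowerSeries k) = (a - p) * b + p * (b - q) := by
      rw [Polynomial.coe_mul]; ring
    rw [this]
    exact dvd_add (h1.mul_right _) (h3.mul_left _)
  · have : x * y - Polynomial.aeval t (p * q) = (x - Polynomial.aeval t p) * y
        + Polynomial.aeval t p * (y - Polynomial.aeval t q) := by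
      rw [map_mul]; ring
    rw [this]
    refine (le_min ?_ ?_).trans (min_le_mk_add _ _)
    · rw [mk_mul]
      exact h2.trans (le_add_of_nonneg_right (hy.finite hk ht))
    · rw [mk_mul]
      exact h4.trans (le_add_of_nonneg_left (mk_nonneg_and_stdPart_aeval hk ht.le p).1)

lemma HasExpansion.aeval {J : Type*} {t : ℝ*} {x : J → ℝ*} {a : J → PowerSeries k}
    (hk : ∀ c : k, algebraMap k ℝ* c = ((algebraMap k ℝ c : ℝ) : ℝ*))
    (ht : 0 < ArchimedeanClass.mk t) (hx : ∀ j, HasExpansion t (x j) (a j))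
    (g : MvPolynomial J k) :
    HasExpansion t (MvPolynomial.aeval x g) (MvPolynomial.aeval a g) := by
  induction g using MvPolynomial.induction_on with
  | C c => simpa [PowerSeries.algebraMap_apply] using hasExpansion_C t c
  | add p q hp hq => simpa only [map_add] using hp.add hq
  | mul_X p j hp => simpa only [map_mul, MvPolynomial.aeval_X] using hp.mul hk ht (hx j)

lemma HasExpansion.sub_leading {t x : ℝ*} {a : PowerSeries k}
    (hk : ∀ c : k, algebraMap k ℝ* c = ((algebraMap k ℝ c : ℝ) : ℝ*))
    (ht : 0 < ArchimedeanClass.mk t) (hx : HasExpansion t x a) {m : ℕ}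
    (hm : ∀ i < m, PowerSeries.coeff i a = 0) :
    (m + 1) • ArchimedeanClass.mk t
      ≤ ArchimedeanClass.mk (x - algebraMap k ℝ* (PowerSeries.coeff m a) * t ^ m) := by
  obtain ⟨p, h1, h2⟩ := hx (m + 1)
  rw [PowerSeries.X_pow_dvd_iff] at h1
  have h3 : ∀ i < m + 1, p.coeff i = PowerSeries.coeff i a := fun i hi => by
    have := h1 i hi
    rw [map_sub, Polynomial.coeff_coe] at this
    exact (sub_eq_zero.1 this).symm
  obtain ⟨q, hq⟩ : (Polynomial.X ^ (m + 1) : Polynomial k) ∣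
      p - Polynomial.monomial m (PowerSeries.coeff m a) := by
    rw [Polynomial.X_pow_dvd_iff]
    intro i hi
    rw [Polynomial.coeff_sub, h3 i hi, Polynomial.coeff_monomial]
    split_ifs with h
    · rw [h, sub_self]
    · rw [hm i (by omega), sub_zero]
  have h4 : x - algebraMap k ℝ* (PowerSeries.coeff m a) * t ^ m
      = (x - Polynomial.aeval t p) + t ^ (m + 1) * Polynomial.aeval t q := by
    have := congrArg (Polynomial.aeval t) hq
    simp only [map_sub, map_mul, map_pow, Polynomial.aeval_X, Polynomial.aeval_monomial] at this
    rw [← this]; ring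
  rw [h4]
  refine (le_min h2 ?_).trans (min_le_mk_add _ _)
  rw [mk_mul, mk_pow]
  exact le_add_of_nonneg_right (mk_nonneg_and_stdPart_aeval hk ht.le q).1

lemma HasExpansion.stdPart_eq {t x : ℝ*} {a : PowerSeries k}
    (hk : ∀ c : k, algebraMap k ℝ* c = ((algebraMap k ℝ c : ℝ) : ℝ*))
    (ht : 0 < ArchimedeanClass.mk t) (hx : HasExpansion t x a) :
    stdPart x = algebraMap k ℝ (PowerSeries.coeff 0 a) := by
  have h := hx.sub_leading hk ht (m := 0) (by simp)
  rw [pow_zero, mul_one, zero_add, one_smul, hk] at h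
  have h1 : stdPart (x - ((algebraMap k ℝ (PowerSeries.coeff 0 a) : ℝ) : ℝ*)) = 0 :=
    stdPart_eq_zero.2 (ht.trans_le h).ne'
  rw [stdPart_sub (hx.finite hk ht) (archimedeanClassMk_coe_nonneg _), stdPart_coe] at h1
  exact sub_eq_zero.1 h1

lemma HasExpansion.mk_eq_and_leading_pos {t x : ℝ*} {a : PowerSeries k}
    (hk : ∀ c : k, algebraMap k ℝ* c = ((algebraMap k ℝ c : ℝ) : ℝ*))
    (ht : 0 < ArchimedeanClass.mk t) (ht0 : 0 < t) (hx : HasExpansion t x a) {m : ℕ}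
    (hm : ∀ i < m, PowerSeries.coeff i a = 0) (ha : PowerSeries.coeff m a ≠ 0) :
    ArchimedeanClass.mk x = m • ArchimedeanClass.mk t ∧
      (0 ≤ x → 0 < algebraMap k ℝ (PowerSeries.coeff m a)) := by
  have h := hx.sub_leading hk ht hm
  set c := PowerSeries.coeff m a
  have h1 : ArchimedeanClass.mk (algebraMap k ℝ* c * t ^ m) = m • ArchimedeanClass.mk t := by
    rw [mk_mul, mk_algebraMap_of_ne_zero hk ha, zero_add, mk_pow]
  have h2 : ArchimedeanClass.mk (algebraMap k ℝ* c * t ^ m)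
      < ArchimedeanClass.mk (x - algebraMap k ℝ* c * t ^ m) := by
    rw [h1]
    exact (nsmul_mk_lt_nsmul_mk ht ht0.ne' (Nat.lt_succ_self m)).trans_le h
  constructor
  · rw [← h1]
    have := mk_add_eq_mk_left h2
    rwa [add_sub_cancel] at this
  · intro hx0
    by_contra hneg
    have h3 : algebraMap k ℝ* c * t ^ m ≤ 0 := by
      refine mul_nonpos_of_nonpos_of_nonneg ?_ (pow_nonneg ht0.le _)
      rw [hk]
      exact_mod_cast not_lt.1 hneg
    refine h2.not_ge (mk_le_mk.2 ⟨1, ?_⟩)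
    rw [one_smul, abs_of_nonpos h3, abs_of_nonneg (by linarith)]
    linarith

lemma HasExpansion.exists_coeff_pos {t x : ℝ*} {a : PowerSeries k}
    (hk : ∀ c : k, algebraMap k ℝ* c = ((algebraMap k ℝ c : ℝ) : ℝ*))
    (ht : 0 < ArchimedeanClass.mk t) (ht0 : 0 < t) (hx : HasExpansion t x a) (hx0 : 0 ≤ x)
    {m : ℕ} (hm : ArchimedeanClass.mk x = m • ArchimedeanClass.mk t) :
    (∀ i < m, PowerSeries.coeff i a = 0) ∧ 0 < algebraMap k ℝ (PowerSeries.coeff m a) := by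
  classical
  have hex : ∃ i, PowerSeries.coeff i a ≠ 0 := by
    by_contra! hall
    have h := hx.sub_leading hk ht (m := m) fun i _ => hall i
    rw [hall m, map_zero, zero_mul, sub_zero, hm] at h
    exact (nsmul_mk_lt_nsmul_mk ht ht0.ne' (Nat.lt_succ_self m)).not_ge h
  have h0 : ∀ i < Nat.find hex, PowerSeries.coeff i a = 0 := fun i hi =>
    not_not.1 (Nat.find_min hex hi)
  obtain ⟨h1, h2⟩ := hx.mk_eq_and_leading_pos hk ht ht0 h0 (Nat.find_spec hex)
  have h3 : Nat.find hex = m := by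
    by_contra hne
    rw [hm] at h1
    rcases lt_or_gt_of_ne hne with h | h
    · exact (nsmul_mk_lt_nsmul_mk ht ht0.ne' h).ne h1.symm
    · exact (nsmul_mk_lt_nsmul_mk ht ht0.ne' h).ne h1
  rw [h3] at h0 h2
  exact ⟨h0, h2 hx0⟩

lemma HasExpansion.eq_zero_or_leading_pos {t x : ℝ*} {a : PowerSeries k}
    (hk : ∀ c : k, algebraMap k ℝ* c = ((algebraMap k ℝ c : ℝ) : ℝ*))
    (ht : 0 < ArchimedeanClass.mk t) (ht0 : 0 < t) (hx : HasExpansion t x a) (hx0 : 0 ≤ x) :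
    a = 0 ∨ ∃ m, (∀ i < m, PowerSeries.coeff i a = 0) ∧
      0 < algebraMap k ℝ (PowerSeries.coeff m a) := by
  classical
  rw [or_iff_not_imp_left]
  intro ha
  have hex : ∃ i, PowerSeries.coeff i a ≠ 0 := by
    by_contra! hall
    exact ha (PowerSeries.ext hall)
  have h0 : ∀ i < Nat.find hex, PowerSeries.coeff i a = 0 := fun i hi =>
    not_not.1 (Nat.find_min hex hi)
  exact ⟨_, h0, (hx.mk_eq_and_leading_pos hk ht ht0 h0 (Nat.find_spec hex)).2 hx0⟩

lemma exists_hasExpansion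
    (hk : ∀ c : k, algebraMap k ℝ* c = ((algebraMap k ℝ c : ℝ) : ℝ*))
    (E : IntermediateField k ℝ*) {t : ℝ*} (htE : t ∈ E) (ht0 : 0 < t)
    (hmin : ∀ y ∈ E, 0 < ArchimedeanClass.mk y → ArchimedeanClass.mk t ≤ ArchimedeanClass.mk y)
    (hres : ∀ y ∈ E, 0 ≤ ArchimedeanClass.mk y → ∃ c : k, algebraMap k ℝ c = stdPart y)
    {x : ℝ*} (hxE : x ∈ E) (hx : 0 ≤ ArchimedeanClass.mk x) :
    ∃ a : PowerSeries k, HasExpansion t x a := by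
  have hstep : ∀ y : {y : ℝ* // y ∈ E ∧ 0 ≤ ArchimedeanClass.mk y},
      ∃ (c : k) (z : {y : ℝ* // y ∈ E ∧ 0 ≤ ArchimedeanClass.mk y}),
        y.1 = algebraMap k ℝ* c + t * z.1 := by
    rintro ⟨y, hyE, hy⟩
    obtain ⟨c, hc⟩ := hres y hyE hy
    have h1 : y - algebraMap k ℝ* c ∈ E := sub_mem hyE (E.algebraMap_mem c)
    have h2 : 0 < ArchimedeanClass.mk (y - algebraMap k ℝ* c) := by
      rw [hk]
      have h3 : 0 ≤ ArchimedeanClass.mk (y - ((algebraMap k ℝ c : ℝ) : ℝ*)) :=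
        (le_min hy (archimedeanClassMk_coe_nonneg _)).trans (min_le_mk_sub _ _)
      refine lt_of_le_of_ne h3 (Ne.symm ?_)
      rw [← stdPart_eq_zero, stdPart_sub hy (archimedeanClassMk_coe_nonneg _), stdPart_coe, hc,
        sub_self]
    have h4 : y - algebraMap k ℝ* c = t * ((y - algebraMap k ℝ* c) / t) := by
      rw [mul_div_cancel₀ _ ht0.ne']
    refine ⟨c, ⟨(y - algebraMap k ℝ* c) / t, div_mem h1 htE, ?_⟩, ?_⟩
    · have h5 := hmin _ h1 h2
      by_contra hneg
      rw [h4, mk_mul] at h5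
      have htop : ArchimedeanClass.mk t ≠ ⊤ := by
        rw [Ne, ArchimedeanClass.mk_eq_top_iff]
        exact ht0.ne'
      have h6 : ArchimedeanClass.mk t + ArchimedeanClass.mk ((y - algebraMap k ℝ* c) / t)
          = ArchimedeanClass.mk t + 0 := by
        rw [add_zero]
        exact le_antisymm (add_le_of_nonpos_right (not_le.1 hneg).le) h5
      exact hneg (add_left_cancel_of_ne_top htop h6).ge
    · rw [← h4, add_sub_cancel]
  choose c nxt hnxt using hstep
  set x₀ : {y : ℝ* // y ∈ E ∧ 0 ≤ ArchimedeanClass.mk y} := ⟨x, hxE, hx⟩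
  have hexp : ∀ n, x = Polynomial.aeval t
      (∑ i ∈ range n, Polynomial.monomial i (c (nxt^[i] x₀))) + t ^ n * (nxt^[n] x₀).1 := by
    intro n
    induction n with
    | zero => simp [x₀]
    | succ n ih =>
      rw [sum_range_succ, map_add, Polynomial.aeval_monomial, Function.iterate_succ_apply']
      conv_lhs => rw [ih, hnxt (nxt^[n] x₀)]
      ring
  refine ⟨PowerSeries.mk fun n => c (nxt^[n] x₀), fun n =>
    ⟨∑ i ∈ range n, Polynomial.monomial i (c (nxt^[i] x₀)), ?_, ?_⟩⟩
  · rw [PowerSeries.X_pow_dvd_iff]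
    intro i hi
    simp [Polynomial.finsetSum_coeff, Polynomial.coeff_monomial, hi]
  · have h := hexp n
    rw [← sub_eq_iff_eq_add'] at h
    rw [h, mk_mul, mk_pow]
    exact le_add_of_nonneg_right (nxt^[n] x₀).2.2

/-- Elements of a finitely generated field of linear growth have simultaneous power series
expansions over a subfield that is algebraically closed in `ℝ`. -/
lemma exists_powerSeries_of_linear_growth {J ι : Type*}
    (hk : ∀ c : k, algebraMap k ℝ* c = ((algebraMap k ℝ c : ℝ) : ℝ*))
    (hcl : ∀ r : ℝ, IsAlgebraic k r → ∃ c : k, algebraMap k ℝ c = r)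
    (u : J → ℝ*) (C : ℕ)
    (hgrow : ∀ (n : ℕ) (κ : Type) [Fintype κ] (f : κ → MvPolynomial J k),
      (∀ l, (f l).totalDegree ≤ n) → LinearIndependent k (fun l => MvPolynomial.aeval u (f l)) →
      Fintype.card κ ≤ C * (n + 1))
    (g : MvPolynomial J k) (hg0 : MvPolynomial.aeval u g ≠ 0)
    (hg : 0 < ArchimedeanClass.mk (MvPolynomial.aeval u g))
    (x : ι → MvPolynomial J k)
    (hfin : ∀ i, 0 ≤ ArchimedeanClass.mk (MvPolynomial.aeval u (x i))) :
    ∃ a : ι → PowerSeries k,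
      (∀ i, algebraMap k ℝ (PowerSeries.coeff 0 (a i)) = stdPart (MvPolynomial.aeval u (x i))) ∧
      (∀ i, 0 < MvPolynomial.aeval u (x i) → ∃ m ≤ C * (x i).totalDegree,
        (∀ j < m, PowerSeries.coeff j (a i) = 0) ∧
          0 < algebraMap k ℝ (PowerSeries.coeff m (a i))) ∧
      ∀ h : MvPolynomial ι k,
        0 ≤ MvPolynomial.aeval (fun i => MvPolynomial.aeval u (x i)) h →
        MvPolynomial.aeval a h = 0 ∨
          ∃ m, (∀ j < m, PowerSeries.coeff j (MvPolynomial.aeval a h) = 0) ∧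
            0 < algebraMap k ℝ (PowerSeries.coeff m (MvPolynomial.aeval a h)) := by
  obtain ⟨t, htE, ht0, ht, hmin⟩ := exists_uniformizer hk u C hgrow g hg0 hg
  have hxE : ∀ i, MvPolynomial.aeval u (x i) ∈ IntermediateField.adjoin k (Set.range u) :=
    fun i => (IntermediateField.mem_adjoin_range_iff _ _ _).2 ⟨x i, 1, by simp⟩
  choose a ha using fun i => exists_hasExpansion hk _ htE ht0 hmin
    (fun y hyE hy => hcl _ (isAlgebraic_stdPart hk u C hgrow g hg0 hg y hyE hy)) (hxE i) (hfin i)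
  refine ⟨a, fun i => ((ha i).stdPart_eq hk ht).symm, fun i hi => ?_, fun h hh =>
    (HasExpansion.aeval hk ht ha h).eq_zero_or_leading_pos hk ht ht0 hh⟩
  obtain ⟨m, hm, hmk⟩ : ∃ m ≤ C * (x i).totalDegree,
      ArchimedeanClass.mk (MvPolynomial.aeval u (x i)) = m • ArchimedeanClass.mk t := by
    rcases (hfin i).eq_or_lt with h | h
    · exact ⟨0, Nat.zero_le _, by rw [← h, zero_smul]⟩
    · exact exists_mk_eq_nsmul hk u C hgrow (x i) hi.ne' h t htE ht0.ne' ht hmin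
  exact ⟨m, hm, (ha i).exists_coeff_pos hk ht ht0 hi.le hmk⟩

end Expansion

section Minimizers

lemma totalDegree_pderiv_le {k J : Type*} [CommSemiring k] (j : J) (p : MvPolynomial J k) :
    (MvPolynomial.pderiv j p).totalDegree ≤ p.totalDegree - 1 := by
  refine Finset.sup_le fun m hm => ?_
  rw [MvPolynomial.mem_support_iff, MvPolynomial.coeff_pderiv] at hm
  have h1 : m + Finsupp.single j 1 ∈ p.support :=
    MvPolynomial.mem_support_iff.2 fun h => hm (by rw [h, zero_mul])
  have h2 := MvPolynomial.le_totalDegree h1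
  rw [Finsupp.sum_add_index' (fun _ => rfl) (fun _ _ _ => rfl),
    Finsupp.sum_single_index rfl] at h2
  exact Nat.le_sub_of_add_le h2

variable {k : Type*} [Field k] [Algebra k ℝ]

lemma continuous_aeval {J X : Type*} [TopologicalSpace X] {v : X → J → ℝ}
    (hv : Continuous v) (p : MvPolynomial J k) :
    Continuous fun x => MvPolynomial.aeval (v x) p := by
  induction p using MvPolynomial.induction_on with
  | C c => simpa using continuous_const
  | add p q hp hq =>
    simp only [map_add]
    exact hp.add hq
  | mul_X p j hp =>
    simp only [map_mul, MvPolynomial.aeval_X]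
    exact hp.mul ((continuous_apply j).comp hv)

lemma hasDerivAt_aeval_update {J : Type*} [DecidableEq J] (v : J → ℝ) (j : J)
    (p : MvPolynomial J k) :
    HasDerivAt (fun s => MvPolynomial.aeval (Function.update v j s) p)
      (MvPolynomial.aeval v (MvPolynomial.pderiv j p)) (v j) := by
  induction p using MvPolynomial.induction_on with
  | C c => simpa using hasDerivAt_const (v j) (algebraMap k ℝ c)
  | add p q hp hq =>
    simp only [map_add]
    exact hp.add hq
  | mul_X p i hp =>
    simp only [map_mul, MvPolynomial.aeval_X, MvPolynomial.pderiv_mul, map_add]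
    have hX : HasDerivAt (fun s => Function.update v j s i)
        (MvPolynomial.aeval v (MvPolynomial.pderiv j (MvPolynomial.X i : MvPolynomial J k)))
        (v j) := by
      by_cases h : i = j
      · subst h
        simpa using hasDerivAt_id' (v i)
      · simpa [Function.update_of_ne h, MvPolynomial.pderiv_X, Pi.single_apply, h] using
          hasDerivAt_const (v j) (v i)
    have := hp.mul hX
    rw [Function.update_eq_self] at this
    exact this.congr_deriv (by ring)

lemma exists_minimizer_add_sum_pow {ι : Type*} [Fintype ι] {q : ℕ} (hq : Even (q + 1))
    {f : (ι → ℝ) → ℝ} (hf : Continuous f) (hf0 : ∀ w, 0 ≤ f w) :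
    ∃ w, ∀ w', f w + ∑ i, w i ^ (q + 1) ≤ f w' + ∑ i, w' i ^ (q + 1) := by
  set Ψ : (ι → ℝ) → ℝ := fun w => f w + ∑ i, w i ^ (q + 1) with hΨ
  have hc : Continuous Ψ := by fun_prop
  set R : ℝ := Ψ 0 + 1 with hR
  have hΨ0 : 0 ≤ Ψ 0 := add_nonneg (hf0 0) (sum_nonneg fun i _ => hq.pow_nonneg _)
  obtain ⟨w, hw, hmin⟩ := (isCompact_Icc (a := fun _ : ι => -R) (b := fun _ => R)).exists_isMinOn
    ⟨0, fun i => by simp only [Pi.zero_apply]; linarith,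
      fun i => by simp only [Pi.zero_apply]; linarith⟩ hc.continuousOn
  have h0 : Ψ w ≤ Ψ 0 := hmin ⟨fun i => by simp only [Pi.zero_apply]; linarith,
      fun i => by simp only [Pi.zero_apply]; linarith⟩
  refine ⟨w, fun w' => ?_⟩
  by_cases hw' : w' ∈ Set.Icc (fun _ : ι => -R) (fun _ => R)
  · exact hmin hw'
  · have : ∃ i, R < |w' i| := by
      by_contra! hall
      exact hw' ⟨fun i => (abs_le.1 (hall i)).1, fun i => (abs_le.1 (hall i)).2⟩
    obtain ⟨i, hi⟩ := this
    have h1 : |w' i| ≤ w' i ^ (q + 1) := by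
      rw [← hq.pow_abs]
      exact le_self_pow₀ (by linarith) (Nat.succ_ne_zero q)
    have h2 : w' i ^ (q + 1) ≤ ∑ i, w' i ^ (q + 1) :=
      single_le_sum (f := fun i => w' i ^ (q + 1)) (fun i _ => hq.pow_nonneg _) (mem_univ i)
    have h3 : Ψ w ≤ Ψ w' := by
      have := hf0 w'
      simp only [hΨ] at *
      linarith
    exact h3

/-- A critical-point equation for penalised polynomials. -/
lemma exists_minimizer_pow_eq {ι : Type*} [Fintype ι] [CharZero k] {q : ℕ}
    (hq : Even (q + 1)) (A B : MvPolynomial (Option ι) k) (δ : ℝ)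
    (hA : ∀ w : ι → ℝ, 0 ≤ MvPolynomial.aeval (fun o : Option ι => o.elim δ w) A)
    (hB : ∀ w : ι → ℝ, 0 ≤ MvPolynomial.aeval (fun o : Option ι => o.elim δ w) B) (i : ℕ) :
    ∃ w : ι → ℝ,
      (∀ w' : ι → ℝ,
        ((i : ℝ) + 1) * MvPolynomial.aeval (fun o : Option ι => o.elim δ w) A
          + ((i : ℝ) + 1) ^ 2 * MvPolynomial.aeval (fun o : Option ι => o.elim δ w) B
        ≤ ((i : ℝ) + 1) * MvPolynomial.aeval (fun o : Option ι => o.elim δ w') A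
          + ((i : ℝ) + 1) ^ 2 * MvPolynomial.aeval (fun o : Option ι => o.elim δ w') B
          + ∑ l, w' l ^ (q + 1)) ∧
      ∀ l, w l ^ q
        = ((i : ℝ) + 1) * MvPolynomial.aeval (fun o : Option ι => o.elim δ w)
          (MvPolynomial.C (-((q : k) + 1)⁻¹) * MvPolynomial.pderiv (some l) A)
        + ((i : ℝ) + 1) ^ 2 * MvPolynomial.aeval (fun o : Option ι => o.elim δ w)
          (MvPolynomial.C (-((q : k) + 1)⁻¹) * MvPolynomial.pderiv (some l) B) := by
  classical
  have hv : Continuous fun (w : ι → ℝ) (o : Option ι) => o.elim δ w := by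
    refine continuous_pi fun o => ?_
    cases o with
    | none => exact continuous_const
    | some l => exact continuous_apply l
  obtain ⟨w, hw⟩ := exists_minimizer_add_sum_pow hq
    (f := fun w : ι → ℝ => ((i : ℝ) + 1) * MvPolynomial.aeval (fun o : Option ι => o.elim δ w) A
          + ((i : ℝ) + 1) ^ 2 * MvPolynomial.aeval (fun o : Option ι => o.elim δ w) B)
    (((continuous_aeval hv A).const_mul _).add ((continuous_aeval hv B).const_mul _))
    (fun w => add_nonneg (mul_nonneg (by positivity) (hA w)) (mul_nonneg (by positivity) (hB w)))
  refine ⟨w, fun w' => le_trans (le_add_of_nonneg_right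
    (sum_nonneg fun l _ => hq.pow_nonneg _)) (hw w'), fun l => ?_⟩
  have hup : ∀ s : ℝ, (fun o : Option ι => o.elim δ (Function.update w l s))
      = Function.update (fun o : Option ι => o.elim δ w) (some l) s := by
    intro s
    funext o
    cases o with
    | none => simp
    | some j =>
      by_cases h : j = l
      · subst h; simp
      · simp [Function.update_of_ne, h]
  have hsum : ∀ s : ℝ, ∑ j, Function.update w l s j ^ (q + 1)
      = s ^ (q + 1) + ∑ j ∈ univ.erase l, w j ^ (q + 1) := by
    intro s
    rw [← add_sum_erase univ _ (mem_univ l), Function.update_self]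
    congr 1
    exact sum_congr rfl fun j hj => by rw [Function.update_of_ne (ne_of_mem_erase hj)]
  set v : Option ι → ℝ := fun o => o.elim δ w with hvdef
  have hder : HasDerivAt (fun s : ℝ => ((i : ℝ) + 1) * MvPolynomial.aeval
        (Function.update v (some l) s) A
      + ((i : ℝ) + 1) ^ 2 * MvPolynomial.aeval (Function.update v (some l) s) B
      + (s ^ (q + 1) + ∑ j ∈ univ.erase l, w j ^ (q + 1)))
      (((i : ℝ) + 1) * MvPolynomial.aeval v (MvPolynomial.pderiv (some l) A)
      + ((i : ℝ) + 1) ^ 2 * MvPolynomial.aeval v (MvPolynomial.pderiv (some l) B)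
      + ((q : ℝ) + 1) * w l ^ q) (w l) := by
    refine ((hasDerivAt_aeval_update v (some l) A).const_mul _ |>.add
      ((hasDerivAt_aeval_update v (some l) B).const_mul _)).add ?_
    have : HasDerivAt (fun s : ℝ => s ^ (q + 1) + ∑ j ∈ univ.erase l, w j ^ (q + 1))
        (((q : ℝ) + 1) * w l ^ q) (w l) := by
      simpa using (hasDerivAt_pow (q + 1) (w l)).add_const (∑ j ∈ univ.erase l, w j ^ (q + 1))
    exact this
  have hmin : IsLocalMin (fun s : ℝ => ((i : ℝ) + 1) * MvPolynomial.aeval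
        (Function.update v (some l) s) A
      + ((i : ℝ) + 1) ^ 2 * MvPolynomial.aeval (Function.update v (some l) s) B
      + (s ^ (q + 1) + ∑ j ∈ univ.erase l, w j ^ (q + 1))) (w l) := by
    refine Eventually.of_forall fun s => ?_
    have h1 := hw (Function.update w l s)
    have h2 := hsum (w l)
    have h3 : Function.update v (some l) (w l) = v := Function.update_eq_self (some l) v
    rw [Function.update_eq_self] at h2
    rw [hsum, hup, h2] at h1
    simp only [h3]
    exact h1
  have h0 := hmin.hasDerivAt_eq_zero hder
  have hq0 : (q : ℝ) + 1 ≠ 0 := by positivity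
  simp only [map_mul, MvPolynomial.aeval_C, map_neg, map_inv₀, map_add, map_natCast, map_one]
  field_simp
  linarith

/-- Limits of penalised minimisers: a zero of `B` near any given zero, satisfying linear growth. -/
lemma exists_zero_linear_growth {ι : Type*} [Fintype ι] [CharZero k] [Algebra k ℝ*]
    (hk : ∀ c : k, algebraMap k ℝ* c = ((algebraMap k ℝ c : ℝ) : ℝ*)) {q : ℕ} (hq2 : 2 ≤ q)
    (hq : Even (q + 1)) (A B : MvPolynomial (Option ι) k)
    (hAdeg : A.totalDegree < q) (hBdeg : B.totalDegree < q) (δ : ℕ → ℝ) (w₀ : ℕ → ι → ℝ)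
    (hA : ∀ j (w : ι → ℝ), 0 ≤ MvPolynomial.aeval (fun o : Option ι => o.elim (δ j) w) A)
    (hB : ∀ j (w : ι → ℝ), 0 ≤ MvPolynomial.aeval (fun o : Option ι => o.elim (δ j) w) B)
    (hB₀ : ∀ j, MvPolynomial.aeval (fun o : Option ι => o.elim (δ j) (w₀ j)) B = 0)
    (hcoer : ∀ j c, ∃ R : ℝ, ∀ w : ι → ℝ,
      MvPolynomial.aeval (fun o : Option ι => o.elim (δ j) w) A ≤ c → ∀ l, |w l| ≤ R) :
    ∃ v : ℕ → Option ι → ℝ, (∀ j, v j none = δ j) ∧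
      (∀ j, MvPolynomial.aeval (v j) B = 0) ∧
      (∀ j, MvPolynomial.aeval (v j) A
        ≤ MvPolynomial.aeval (fun o : Option ι => o.elim (δ j) (w₀ j)) A) ∧
      ∀ (n : ℕ) (κ : Type) [Fintype κ] (f : κ → MvPolynomial (Option ι) k),
        (∀ l, (f l).totalDegree ≤ n) →
        LinearIndependent k
          (fun l => MvPolynomial.aeval (fun o => ofSeq fun j => v j o) (f l)) →
        Fintype.card κ ≤ 4 * q ^ Fintype.card ι * (n + 1) := by
  choose w hw1 hw2 using fun j i => exists_minimizer_pow_eq hq A B (δ j) (hA j) (hB j) i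
  set a : ℕ → ℝ := fun j => MvPolynomial.aeval (fun o : Option ι => o.elim (δ j) (w₀ j)) A
  set S : ℕ → ℝ := fun j => ∑ l, w₀ j l ^ (q + 1)
  have hS : ∀ j, 0 ≤ S j := fun j => sum_nonneg fun l _ => hq.pow_nonneg _
  have hT : ∀ i : ℕ, (0 : ℝ) < (i : ℝ) + 1 := fun i => by positivity
  have hle : ∀ (j i : ℕ), ((i : ℝ) + 1) * MvPolynomial.aeval
        (fun o : Option ι => o.elim (δ j) (w j i)) A
      + ((i : ℝ) + 1) ^ 2 * MvPolynomial.aeval (fun o : Option ι => o.elim (δ j) (w j i)) B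
      ≤ ((i : ℝ) + 1) * a j + S j := fun j i => by
    have := hw1 j i (w₀ j)
    rwa [hB₀ j, mul_zero, add_zero] at this
  have hAle : ∀ (j i : ℕ), MvPolynomial.aeval (fun o : Option ι => o.elim (δ j) (w j i)) A
      ≤ a j + S j / ((i : ℝ) + 1) := fun j i => by
    have h1 := hle j i
    have h2 := mul_nonneg (pow_nonneg (hT i).le 2) (hB j (w j i))
    rw [← mul_le_mul_iff_right₀ (hT i), mul_add, mul_div_cancel₀ _ (hT i).ne']
    linarith
  have hBle : ∀ (j i : ℕ), MvPolynomial.aeval (fun o : Option ι => o.elim (δ j) (w j i)) B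
      ≤ a j / ((i : ℝ) + 1) + S j / ((i : ℝ) + 1) ^ 2 := fun j i => by
    have h1 := hle j i
    have h2 := mul_nonneg (hT i).le (hA j (w j i))
    rw [← mul_le_mul_iff_right₀ (pow_pos (hT i) 2), mul_add,
      mul_div_cancel₀ _ (pow_pos (hT i) 2).ne']
    have h3 : ((i : ℝ) + 1) ^ 2 * (a j / ((i : ℝ) + 1)) = ((i : ℝ) + 1) * a j := by
      field_simp [(hT i).ne']
    linarith
  have hbd : ∀ j, ∃ R : ℝ, ∀ i l, |w j i l| ≤ R := fun j => by
    obtain ⟨R, hR⟩ := hcoer j (a j + S j)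
    refine ⟨R, fun i => hR _ ((hAle j i).trans ?_)⟩
    gcongr
    exact div_le_self (hS j) (by linarith [Nat.cast_nonneg (α := ℝ) i])
  have hlim : ∀ j, ∃ z : ι → ℝ, Tendsto (w j) (hyperfilter ℕ : Filter ℕ) (𝓝 z) := fun j => by
    obtain ⟨R, hR⟩ := hbd j
    obtain ⟨z, -, hz⟩ := (isCompact_Icc (a := fun _ : ι => -R) (b := fun _ => R)).ultrafilter_le_nhds
      ((hyperfilter ℕ).map (w j)) (by
        rw [le_principal_iff, Ultrafilter.coe_map, Filter.mem_map]
        exact univ_mem' fun i =>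
          ⟨fun l => (abs_le.1 (hR i l)).1, fun l => (abs_le.1 (hR i l)).2⟩)
    exact ⟨z, hz⟩
  choose z hz using hlim
  have hv : ∀ j, Continuous fun (w : ι → ℝ) (o : Option ι) => o.elim (δ j) w := by
    refine fun j => continuous_pi fun o => ?_
    cases o with
    | none => exact continuous_const
    | some l => exact continuous_apply l
  have hTlim : Tendsto (fun i : ℕ => ((i : ℝ) + 1)) (hyperfilter ℕ : Filter ℕ) atTop :=
    (tendsto_atTop_add_const_right _ _ tendsto_natCast_atTop_atTop).mono_left
      Nat.hyperfilter_le_atTop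
  have hpoly : ∀ j (Q : MvPolynomial (Option ι) k), Tendsto
      (fun i => MvPolynomial.aeval (fun o : Option ι => o.elim (δ j) (w j i)) Q)
      (hyperfilter ℕ : Filter ℕ)
      (𝓝 (MvPolynomial.aeval (fun o : Option ι => o.elim (δ j) (z j)) Q)) := fun j Q =>
    ((continuous_aeval (hv j) Q).tendsto _).comp (hz j)
  refine ⟨fun j o => o.elim (δ j) (z j), fun j => rfl, fun j => ?_, fun j => ?_, ?_⟩
  · refine le_antisymm ?_ (hB j _)
    have h1 : Tendsto (fun i : ℕ => a j / ((i : ℝ) + 1) + S j / ((i : ℝ) + 1) ^ 2)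
        (hyperfilter ℕ : Filter ℕ) (𝓝 (0 + 0)) :=
      (hTlim.const_div_atTop _).add
        (((tendsto_pow_atTop two_ne_zero).comp hTlim).const_div_atTop _)
    rw [add_zero] at h1
    exact le_of_tendsto_of_tendsto' (hpoly j B) h1 (hBle j)
  · have h1 : Tendsto (fun i : ℕ => a j + S j / ((i : ℝ) + 1))
        (hyperfilter ℕ : Filter ℕ) (𝓝 (a j + 0)) := (hTlim.const_div_atTop _).const_add _
    rw [add_zero] at h1
    exact le_of_tendsto_of_tendsto' (hpoly j A) h1 (hAle j)
  · intro n κ _ f hf hind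
    have hdeg : ∀ (Q : MvPolynomial (Option ι) k), Q.totalDegree < q → ∀ l : ι,
        (MvPolynomial.C (-((q : k) + 1)⁻¹)
          * MvPolynomial.pderiv (some l) Q).totalDegree + 2 ≤ q := by
      intro Q hQ l
      have h1 := MvPolynomial.totalDegree_mul (MvPolynomial.C (-((q : k) + 1)⁻¹))
        (MvPolynomial.pderiv (some l) Q)
      rw [MvPolynomial.totalDegree_C, zero_add] at h1
      have h2 := totalDegree_pderiv_le (some l) Q
      omega
    have := card_le_of_linearIndependent_aeval hk Nat.hyperfilter_le_atTop
      (fun j i o => o.elim (δ j) (w j i)) (fun j o => o.elim (δ j) (z j)) (fun j o => by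
        cases o with
        | none => exact tendsto_const_nhds
        | some l => exact (tendsto_pi_nhds.1 (hz j)) l) q _ _ (hdeg A hAdeg) (hdeg B hBdeg)
      hw2 n f hf hind
    linarith

end Minimizers

section Curve

lemma totalDegree_aeval_le {k P J : Type*} [CommSemiring k] (f : P → MvPolynomial J k) (e : ℕ)
    (hf : ∀ s, (f s).totalDegree ≤ e) (g : MvPolynomial P k) :
    (MvPolynomial.aeval f g).totalDegree ≤ e * g.totalDegree := by
  rw [MvPolynomial.aeval_def, MvPolynomial.eval₂_eq]
  refine MvPolynomial.totalDegree_finsetSum_le fun m hm => ?_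
  have h1 := MvPolynomial.totalDegree_mul
    (algebraMap k (MvPolynomial J k) (g.coeff m)) (∏ i ∈ m.support, f i ^ m i)
  have h2 : (algebraMap k (MvPolynomial J k) (g.coeff m)).totalDegree = 0 :=
    MvPolynomial.totalDegree_C _
  have h3 : (∏ i ∈ m.support, f i ^ m i).totalDegree ≤ ∑ i ∈ m.support, m i * e :=
    (MvPolynomial.totalDegree_finsetProd _ _).trans (sum_le_sum fun i _ =>
      (MvPolynomial.totalDegree_pow _ _).trans (Nat.mul_le_mul_left _ (hf i)))
  rw [← sum_mul] at h3
  have h4 : (∑ i ∈ m.support, m i) * e ≤ g.totalDegree * e :=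
    Nat.mul_le_mul_right _ (MvPolynomial.le_totalDegree hm)
  rw [mul_comm e]
  omega

variable {k : Type*} [Field k] [Algebra k ℝ]

/-- A limit of solutions of a finite system of polynomial inequalities with positive coordinates
is the constant coefficient of a power series solution of controlled order. -/
theorem exists_powerSeries_curve [CharZero k] {P I : Type*} [Fintype P] [Fintype I]
    (hcl : ∀ r : ℝ, IsAlgebraic k r → ∃ c : k, algebraMap k ℝ c = r) {d : ℕ} (hd : 1 ≤ d)
    (g : I → MvPolynomial P k) (hg : ∀ i, (g i).totalDegree ≤ d) (σ : P → k)
    (x : ℕ → P → ℝ) (hx : ∀ j s, 0 < x j s) (hgx : ∀ j i, 0 ≤ MvPolynomial.aeval (x j) (g i))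
    (hlim : Tendsto x atTop (𝓝 fun s => algebraMap k ℝ (σ s))) :
    ∃ a : P → PowerSeries k,
      (∀ s, PowerSeries.coeff 0 (a s) = σ s) ∧
      (∀ s, ∃ m ≤ 8 * (4 * d + 1) ^ (Fintype.card P + Fintype.card I),
        (∀ j < m, PowerSeries.coeff j (a s) = 0) ∧
          0 < algebraMap k ℝ (PowerSeries.coeff m (a s))) ∧
      ∀ i, MvPolynomial.aeval a (g i) = 0 ∨
        ∃ m, (∀ j < m, PowerSeries.coeff j (MvPolynomial.aeval a (g i)) = 0) ∧
          0 < algebraMap k ℝ (PowerSeries.coeff m (MvPolynomial.aeval a (g i))) := by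
  classical
  let _ : Algebra k ℝ* := (coeRingHom.toRingHom.comp (algebraMap k ℝ)).toAlgebra
  have hk : ∀ c : k, algebraMap k ℝ* c = ((algebraMap k ℝ c : ℝ) : ℝ*) := fun _ => rfl
  have hδex : ∀ j : ℕ, ∃ δ : ℝ, 0 < δ ∧ δ ≤ 1 / ((j : ℝ) + 1) ∧ ∀ s, δ ≤ x j s := fun j => by
    have h : ∀ r : ℝ, 0 < r → ∀ᶠ δ in 𝓝[>] (0 : ℝ), δ ≤ r := fun r hr =>
      Filter.mem_of_superset (Ioc_mem_nhdsGT hr) fun _ h => h.2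
    have h1 : ∀ᶠ δ in 𝓝[>] (0 : ℝ), 0 < δ := self_mem_nhdsWithin
    exact (h1.and ((h _ (by positivity)).and (eventually_all.2 fun s => h _ (hx j s)))).exists
  choose δ hδ0 hδ1 hδx using hδex
  let X : P → MvPolynomial (Option (P ⊕ I)) k := fun s =>
    MvPolynomial.X none + MvPolynomial.X (some (Sum.inl s)) ^ 2
  let Y : I → MvPolynomial (Option (P ⊕ I)) k := fun i => MvPolynomial.X (some (Sum.inr i)) ^ 2
  let γ : I → k := fun i => MvPolynomial.aeval σ (g i)
  let A : MvPolynomial (Option (P ⊕ I)) k :=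
    ∑ s, (X s - MvPolynomial.C (σ s)) ^ 2 + ∑ i, (Y i - MvPolynomial.C (γ i)) ^ 2
  let B : MvPolynomial (Option (P ⊕ I)) k := ∑ i, (MvPolynomial.aeval X (g i) - Y i) ^ 2
  have hAval : ∀ v : Option (P ⊕ I) → ℝ, MvPolynomial.aeval v A
      = ∑ s, (v none + v (some (Sum.inl s)) ^ 2 - algebraMap k ℝ (σ s)) ^ 2
        + ∑ i, (v (some (Sum.inr i)) ^ 2 - algebraMap k ℝ (γ i)) ^ 2 := fun v => by
    simp [A, X, Y]
  have hXval : ∀ (v : Option (P ⊕ I) → ℝ) i, MvPolynomial.aeval v (MvPolynomial.aeval X (g i))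
      = MvPolynomial.aeval (fun s => v none + v (some (Sum.inl s)) ^ 2) (g i) := fun v i => by
    rw [← MvPolynomial.bind₁, MvPolynomial.aeval_bind₁]
    simp [X]
  have hBval : ∀ v : Option (P ⊕ I) → ℝ, MvPolynomial.aeval v B
      = ∑ i, (MvPolynomial.aeval (fun s => v none + v (some (Sum.inl s)) ^ 2) (g i)
        - v (some (Sum.inr i)) ^ 2) ^ 2 := fun v => by
    simp only [B, Y, map_sum, map_pow, map_sub, hXval, MvPolynomial.aeval_X]
  have hXdeg : ∀ s, (X s).totalDegree ≤ 2 := fun s =>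
    (MvPolynomial.totalDegree_add _ _).trans (by
      rw [MvPolynomial.totalDegree_X_pow, MvPolynomial.totalDegree_X]; norm_num)
  have hYdeg : ∀ i, (Y i).totalDegree ≤ 2 := fun i => (MvPolynomial.totalDegree_X_pow _ _).le
  have hsq : ∀ (p q : MvPolynomial (Option (P ⊕ I)) k) (e : ℕ), p.totalDegree ≤ 2 * e →
      q.totalDegree ≤ 2 * e → ((p - q) ^ 2).totalDegree ≤ 4 * e := fun p q e hp hq => by
    have h1 := MvPolynomial.totalDegree_pow (p - q) 2
    have h2 := (MvPolynomial.totalDegree_sub p q).trans (max_le hp hq)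
    omega
  have hAdeg : A.totalDegree < 4 * d + 1 := by
    have h1 : (∑ s, (X s - MvPolynomial.C (σ s)) ^ 2).totalDegree ≤ 4 * d :=
      MvPolynomial.totalDegree_finsetSum_le fun s _ =>
        hsq _ _ _ ((hXdeg s).trans (by omega)) (by rw [MvPolynomial.totalDegree_C]; omega)
    have h2 : (∑ i, (Y i - MvPolynomial.C (γ i)) ^ 2).totalDegree ≤ 4 * d :=
      MvPolynomial.totalDegree_finsetSum_le fun i _ =>
        hsq _ _ _ ((hYdeg i).trans (by omega)) (by rw [MvPolynomial.totalDegree_C]; omega)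
    have h3 := (MvPolynomial.totalDegree_add (∑ s, (X s - MvPolynomial.C (σ s)) ^ 2)
      (∑ i, (Y i - MvPolynomial.C (γ i)) ^ 2)).trans (max_le h1 h2)
    exact Nat.lt_succ_of_le h3
  have hBdeg : B.totalDegree < 4 * d + 1 := by
    refine Nat.lt_succ_of_le (MvPolynomial.totalDegree_finsetSum_le fun i _ =>
      hsq _ _ _ ((totalDegree_aeval_le X 2 hXdeg (g i)).trans ?_) ((hYdeg i).trans (by omega)))
    exact Nat.mul_le_mul_left _ (hg i)
  let w₀ : ℕ → P ⊕ I → ℝ := fun j => Sum.elim (fun s => √(x j s - δ j))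
    (fun i => √(MvPolynomial.aeval (x j) (g i)))
  have hw₀x : ∀ j s, δ j + w₀ j (Sum.inl s) ^ 2 = x j s := fun j s => by
    simp only [w₀, Sum.elim_inl, Real.sq_sqrt (sub_nonneg.2 (hδx j s)), add_sub_cancel]
  have hw₀y : ∀ j i, w₀ j (Sum.inr i) ^ 2 = MvPolynomial.aeval (x j) (g i) := fun j i => by
    simp only [w₀, Sum.elim_inr, Real.sq_sqrt (hgx j i)]
  obtain ⟨v, hv0, hvB, hvA, hgrow⟩ := exists_zero_linear_growth hk (q := 4 * d + 1) (by omega)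
    ⟨2 * d + 1, by ring⟩ A B hAdeg hBdeg δ w₀
    (fun j w => by rw [hAval]; positivity) (fun j w => by rw [hBval]; positivity)
    (fun j => by
      rw [hBval]
      refine sum_eq_zero fun i _ => ?_
      simp only [Option.elim, hw₀x, hw₀y]
      ring)
    (fun j c => by
      refine ⟨|c| + 2 + ∑ s, |algebraMap k ℝ (σ s)| + ∑ i, |algebraMap k ℝ (γ i)|,
        fun w hw l => ?_⟩
      rw [hAval] at hw
      simp only [Option.elim] at hw
      have hs : ∀ s, (δ j + w (Sum.inl s) ^ 2 - algebraMap k ℝ (σ s)) ^ 2 ≤ c := fun s => by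
        refine le_trans ?_ hw
        exact le_add_of_le_of_nonneg (single_le_sum
          (f := fun s => (δ j + w (Sum.inl s) ^ 2 - algebraMap k ℝ (σ s)) ^ 2)
          (fun _ _ => sq_nonneg _) (mem_univ s)) (sum_nonneg fun _ _ => sq_nonneg _)
      have hi : ∀ i, (w (Sum.inr i) ^ 2 - algebraMap k ℝ (γ i)) ^ 2 ≤ c := fun i => by
        refine le_trans ?_ hw
        exact le_add_of_nonneg_of_le (sum_nonneg fun _ _ => sq_nonneg _) (single_le_sum
          (f := fun i => (w (Sum.inr i) ^ 2 - algebraMap k ℝ (γ i)) ^ 2)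
          (fun _ _ => sq_nonneg _) (mem_univ i))
      have hσ0 : 0 ≤ ∑ s, |algebraMap k ℝ (σ s)| := sum_nonneg fun _ _ => abs_nonneg _
      have hγ0 : 0 ≤ ∑ i, |algebraMap k ℝ (γ i)| := sum_nonneg fun _ _ => abs_nonneg _
      have hc := le_abs_self c
      have hδj := hδ0 j
      rcases l with s | i
      · have h1 : |algebraMap k ℝ (σ s)| ≤ ∑ s, |algebraMap k ℝ (σ s)| :=
          single_le_sum (f := fun s => |algebraMap k ℝ (σ s)|) (fun _ _ => abs_nonneg _)
            (mem_univ s)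
        have h2 := le_abs_self (algebraMap k ℝ (σ s))
        have h3 := hs s
        have h4 := sq_abs (w (Sum.inl s))
        nlinarith [sq_nonneg (δ j + w (Sum.inl s) ^ 2 - algebraMap k ℝ (σ s) - 1),
          sq_nonneg (|w (Sum.inl s)| - 1)]
      · have h1 : |algebraMap k ℝ (γ i)| ≤ ∑ i, |algebraMap k ℝ (γ i)| :=
          single_le_sum (f := fun i => |algebraMap k ℝ (γ i)|) (fun _ _ => abs_nonneg _)
            (mem_univ i)
        have h2 := le_abs_self (algebraMap k ℝ (γ i))
        have h3 := hi i
        have h4 := sq_abs (w (Sum.inr i))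
        nlinarith [sq_nonneg (w (Sum.inr i) ^ 2 - algebraMap k ℝ (γ i) - 1),
          sq_nonneg (|w (Sum.inr i)| - 1)])
  set u : Option (P ⊕ I) → ℝ* := fun o => ofSeq fun j => v j o with hu
  have hδlim : Tendsto δ atTop (𝓝 0) :=
    squeeze_zero (fun j => (hδ0 j).le) hδ1 tendsto_one_div_add_atTop_nhds_zero_nat
  have hA₀ : Tendsto (fun j => MvPolynomial.aeval (fun o : Option (P ⊕ I) => o.elim (δ j) (w₀ j)) A)
      atTop (𝓝 0) := by
    simp only [hAval, Option.elim, hw₀x, hw₀y]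
    have h1 : ∀ s, Tendsto (fun j => (x j s - algebraMap k ℝ (σ s)) ^ 2) atTop (𝓝 0) :=
      fun s => by
        simpa using ((tendsto_pi_nhds.1 hlim s).sub_const (algebraMap k ℝ (σ s))).pow 2
    have h2 : ∀ i, Tendsto (fun j => (MvPolynomial.aeval (x j) (g i) - algebraMap k ℝ (γ i)) ^ 2)
        atTop (𝓝 0) := fun i => by
      have h3 := ((continuous_aeval continuous_id (g i)).tendsto
        (fun s => algebraMap k ℝ (σ s))).comp hlim
      have h4 : MvPolynomial.aeval (fun s => algebraMap k ℝ (σ s)) (g i)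
          = algebraMap k ℝ (γ i) := MvPolynomial.aeval_algebraMap_apply _ _ _
      simp only [id, h4] at h3
      simpa using (h3.sub_const (algebraMap k ℝ (γ i))).pow 2
    simpa using (tendsto_finsetSum univ fun s _ => h1 s).add
      (tendsto_finsetSum univ fun i _ => h2 i)
  have hXu : ∀ s, MvPolynomial.aeval u (X s)
      = ofSeq fun j => δ j + v j (some (Sum.inl s)) ^ 2 := fun s => by
    rw [hu, ofSeq_aeval hk]
    simp [X, hv0]
  have hXlim : ∀ s, (ofSeq fun j => δ j + v j (some (Sum.inl s)) ^ 2).Tendsto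
      (𝓝 (algebraMap k ℝ (σ s))) := fun s => by
    have h1 : ∀ j, (δ j + v j (some (Sum.inl s)) ^ 2 - algebraMap k ℝ (σ s)) ^ 2
        ≤ MvPolynomial.aeval (fun o : Option (P ⊕ I) => o.elim (δ j) (w₀ j)) A := fun j => by
      refine le_trans ?_ (hvA j)
      rw [hAval, hv0]
      exact le_add_of_le_of_nonneg (single_le_sum
        (f := fun s => (δ j + v j (some (Sum.inl s)) ^ 2 - algebraMap k ℝ (σ s)) ^ 2)
        (fun _ _ => sq_nonneg _) (mem_univ s)) (sum_nonneg fun _ _ => sq_nonneg _)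
    have h2 := squeeze_zero (fun j => sq_nonneg _) h1 hA₀
    have h3 : Tendsto (fun j => δ j + v j (some (Sum.inl s)) ^ 2) atTop
        (𝓝 (algebraMap k ℝ (σ s))) := by
      rw [tendsto_iff_dist_tendsto_zero]
      have h4 := h2.sqrt
      simpa only [Real.sqrt_sq_eq_abs, Real.sqrt_zero, ← Real.dist_eq] using h4
    exact h3.mono_left Nat.hyperfilter_le_atTop
  have hX0 : ∀ s, 0 < MvPolynomial.aeval u (X s) := fun s => by
    rw [hXu]
    exact ofSeq_lt_ofSeq.2 (Eventually.of_forall fun j => by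
      have := hδ0 j
      positivity)
  have hnone : MvPolynomial.aeval u (MvPolynomial.X none : MvPolynomial (Option (P ⊕ I)) k)
      = ofSeq δ := by
    rw [MvPolynomial.aeval_X, hu]
    simp only [hv0]
  obtain ⟨a, ha0, hapos, hag⟩ := exists_powerSeries_of_linear_growth hk hcl u
    (4 * (4 * d + 1) ^ Fintype.card (P ⊕ I)) hgrow (MvPolynomial.X none)
    (by
      rw [hnone]
      have : 0 < ofSeq δ := ofSeq_lt_ofSeq.2 (Eventually.of_forall hδ0)
      exact this.ne')
    (by
      rw [hnone]
      exact archimedeanClassMk_pos_of_tendsto (hδlim.mono_left Nat.hyperfilter_le_atTop)) X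
    (fun s => by
      rw [hXu]
      exact archimedeanClassMk_nonneg_of_tendsto (hXlim s))
  refine ⟨a, fun s => ?_, fun s => ?_, fun i => hag (g i) ?_⟩
  · have := ha0 s
    rw [hXu, stdPart_of_tendsto (hXlim s)] at this
    exact (algebraMap k ℝ).injective this
  · obtain ⟨m, hm, h⟩ := hapos s (hX0 s)
    refine ⟨m, hm.trans ?_, h⟩
    rw [Fintype.card_sum]
    calc _ ≤ 4 * (4 * d + 1) ^ (Fintype.card P + Fintype.card I) * 2 :=
          Nat.mul_le_mul_left _ (hXdeg s)
      _ = _ := by ring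
  · have h1 : MvPolynomial.aeval (fun s => MvPolynomial.aeval u (X s)) (g i)
        = MvPolynomial.aeval u (MvPolynomial.aeval X (g i)) := by
      rw [← MvPolynomial.bind₁, MvPolynomial.aeval_bind₁]
    rw [h1, hu, ofSeq_aeval hk]
    refine ofSeq_le_ofSeq.2 (Eventually.of_forall fun j => ?_)
    have h2 := hvB j
    rw [hBval, sum_eq_zero_iff_of_nonneg fun _ _ => sq_nonneg _] at h2
    have h3 := sub_eq_zero.1 (pow_eq_zero_iff two_ne_zero |>.1 (h2 i (mem_univ i)))
    rw [hXval, h3]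
    exact sq_nonneg _

end Curve

section LeadingCoefficients

/-- The power series `f` has order `m` and a positive leading coefficient. -/
def PosLead (f : PowerSeries ℝ) (m : ℕ) : Prop :=
  (∀ j < m, PowerSeries.coeff j f = 0) ∧ 0 < PowerSeries.coeff m f

theorem PosLead.mul {f w : PowerSeries ℝ} {m : ℕ} (hf : PosLead f m)
    (hw : 0 < PowerSeries.constantCoeff w) : PosLead (f * w) m := by
  obtain ⟨g, rfl⟩ := PowerSeries.X_pow_dvd_iff.2 hf.1
  have h := hf.2
  rw [PowerSeries.coeff_X_pow_mul', if_pos le_rfl, Nat.sub_self,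
    PowerSeries.coeff_zero_eq_constantCoeff_apply] at h
  refine ⟨PowerSeries.X_pow_dvd_iff.1 ⟨g * w, mul_assoc _ _ _⟩, ?_⟩
  rw [mul_assoc, PowerSeries.coeff_X_pow_mul', if_pos le_rfl, Nat.sub_self,
    PowerSeries.coeff_zero_eq_constantCoeff_apply, map_mul]
  exact mul_pos h hw

theorem PosLead.rescale {f : PowerSeries ℝ} {m : ℕ} (hf : PosLead f m) {c : ℝ} (hc : 0 < c) :
    PosLead (PowerSeries.rescale c f) m := by
  refine ⟨fun j hj => ?_, ?_⟩
  · rw [PowerSeries.coeff_rescale, hf.1 j hj, mul_zero]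
  · rw [PowerSeries.coeff_rescale]
    exact mul_pos (pow_pos hc m) hf.2

theorem rescale_C (c a : ℝ) :
    PowerSeries.rescale c (PowerSeries.C a) = PowerSeries.C a := by
  ext i
  rw [PowerSeries.coeff_rescale, PowerSeries.coeff_C]
  split_ifs with h
  · rw [h, pow_zero, one_mul]
  · rw [mul_zero]

theorem coeff_mul_mk_one (f : PowerSeries ℝ) (k : ℕ) :
    PowerSeries.coeff k (f * PowerSeries.mk 1) = ∑ i ∈ range (k + 1), PowerSeries.coeff i f := by
  rw [PowerSeries.coeff_mul, Finset.Nat.sum_antidiagonal_eq_sum_range_succ_mk]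
  simp

theorem PosLead.eventually_partialSum_nonneg {f : PowerSeries ℝ} {m : ℕ} (hf : PosLead f m)
    (k : ℕ) : ∀ᶠ c in 𝓝[>] (0 : ℝ),
      0 ≤ ∑ i ∈ range (k + 1), c ^ i * PowerSeries.coeff i f := by
  rcases lt_or_ge k m with hk | hk
  · refine Eventually.of_forall fun c => (sum_eq_zero fun i hi => ?_).ge
    rw [hf.1 i (by have := mem_range.1 hi; omega), mul_zero]
  · have h1 : Tendsto (fun c : ℝ => ∑ i ∈ range (k - m + 1), c ^ i * PowerSeries.coeff (m + i) f)
        (𝓝 0) (𝓝 (∑ i ∈ range (k - m + 1), (0 : ℝ) ^ i * PowerSeries.coeff (m + i) f)) :=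
      Continuous.tendsto (by fun_prop) 0
    have h2 : ∑ i ∈ range (k - m + 1), (0 : ℝ) ^ i * PowerSeries.coeff (m + i) f
        = PowerSeries.coeff m f := by
      rw [sum_range_succ']
      simp
    rw [h2] at h1
    filter_upwards [(h1.eventually_const_lt hf.2).filter_mono nhdsWithin_le_nhds,
      self_mem_nhdsWithin] with c hc hc0
    obtain ⟨l, rfl⟩ := Nat.exists_eq_add_of_le hk
    rw [add_assoc, sum_range_add, sum_eq_zero, zero_add]
    · rw [Nat.add_sub_cancel_left] at hc
      have h3 : ∑ i ∈ range (l + 1), c ^ (m + i) * PowerSeries.coeff (m + i) f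
          = c ^ m * ∑ i ∈ range (l + 1), c ^ i * PowerSeries.coeff (m + i) f := by
        rw [mul_sum]
        exact sum_congr rfl fun i _ => by ring
      rw [h3]
      exact mul_nonneg (pow_nonneg (le_of_lt hc0) _) hc.le
    · intro i hi
      rw [hf.1 i (mem_range.1 hi), mul_zero]

theorem PosLead.coeff_rescale_mul_mk_one_ne_zero {f : PowerSeries ℝ} {m : ℕ} (hf : PosLead f m)
    {c : ℝ} (hc : 0 < c) :
    PowerSeries.coeff m (PowerSeries.rescale c f * PowerSeries.mk 1) ≠ 0 :=
  ((hf.rescale hc).mul (by simp)).2.ne'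

end LeadingCoefficients

section Games

variable {S : Fin N → Type}

theorem combine_self (n : Fin N) (t : S n) (so : ∀ m : {m : Fin N // m ≠ n}, S m.val) :
    combine n t so n = t := by
  simp [combine]

theorem combine_of_ne (n : Fin N) (t : S n) (so : ∀ m : {m : Fin N // m ≠ n}, S m.val)
    (m : {m : Fin N // m ≠ n}) : combine n t so m = so m := by
  simp [combine, m.2]

theorem prod_eq_mul_prod_ne {M : Type*} [CommMonoid M] (n : Fin N) (f : Fin N → M) :
    ∏ m, f m = f n * ∏ m : {m : Fin N // m ≠ n}, f m := by
  rw [Fintype.prod_eq_mul_prod_compl n f]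
  congr 1
  exact (Finset.prod_subtype _ (by simp) _)

variable [∀ n, Fintype (S n)]

theorem payoff_update (G : Fin N → (∀ m, S m) → ℝ) (n : Fin N) (τ : Profile S) (τn : S n → ℝ) :
    payoff G n (Function.update τ n τn)
      = ∑ so : ∀ m : {m : Fin N // m ≠ n}, S m.val,
          (∑ t, τn t * G n (combine n t so)) * ∏ m : {m : Fin N // m ≠ n}, τ m (so m) := by
  simp_rw [sum_mul]
  rw [payoff, ← Fintype.sum_prod_type' (f := fun (so : ∀ m : {m : Fin N // m ≠ n}, S m.val) t =>
    τn t * G n (combine n t so) * ∏ m : {m : Fin N // m ≠ n}, τ m (so m))]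
  refine (Fintype.sum_equiv (κ := ∀ m, S m)
    ⟨fun p : (∀ m : {m : Fin N // m ≠ n}, S m.val) × S n => combine n p.2 p.1, fun s => (fun m => s m, s n), fun p => ?_, fun s => ?_⟩
    _ _ fun p => ?_).symm
  · refine Prod.ext (funext fun m => combine_of_ne n _ _ m) (combine_self n _ _)
  · funext m
    by_cases h : m = n
    · subst h
      exact combine_self _ _ _
    · exact combine_of_ne n _ _ ⟨m, h⟩
  · simp only [Equiv.coe_fn_mk]
    rw [prod_eq_mul_prod_ne n, Function.update_self, combine_self]
    have : ∀ m : {m : Fin N // m ≠ n}, Function.update τ n τn m (combine n p.2 p.1 m)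
        = τ m (p.1 m) := fun m => by
      rw [Function.update_of_ne m.2, combine_of_ne]
    rw [prod_congr rfl fun m _ => this m]
    ring

theorem ubelief_eq_coeff_prod {K k : ℕ} (hk : k ≤ K) (p : ∀ n, S n → PowerSeries ℝ) (n : Fin N)
    (so : ∀ m : {m : Fin N // m ≠ n}, S m.val) :
    ubelief (K := K) (fun n i s => PowerSeries.coeff (i : ℕ) (p n s)) n k so
      = PowerSeries.coeff k (∏ m : {m : Fin N // m ≠ n}, p m (so m)) := by
  classical
  rw [PowerSeries.coeff_prod, ubelief]
  have hle : ∀ l ∈ finsuppAntidiag (univ : Finset {m : Fin N // m ≠ n}) k, ∀ m, l m < K + 1 :=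
    fun l hl m => by
      have h1 : ∑ m, l m = k := (mem_finsuppAntidiag.1 hl).1
      have h2 : l m ≤ ∑ m, l m := single_le_sum (f := fun m => l m) (fun _ _ => Nat.zero_le _) (mem_univ m)
      omega
  refine sum_bij' (fun kv _ => Finsupp.equivFunOnFinite.symm fun m => (kv m : ℕ))
    (fun l hl m => ⟨l m, hle l hl m⟩) ?_ ?_ ?_ ?_ ?_
  · intro kv hkv
    simpa [mem_finsuppAntidiag] using hkv
  · intro l hl
    simpa using (mem_finsuppAntidiag.1 hl).1
  · intro kv _
    rfl
  · intro l _
    ext m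
    simp
  · intro kv _
    simp

theorem sum_ubelief_pos {K k : ℕ} (hN : 2 ≤ N) (hk : k ≤ K) (p : ∀ n, S n → PowerSeries ℝ)
    (hp : ∀ n, ∑ s, p n s = PowerSeries.mk 1) (n : Fin N) :
    0 < ∑ so, ubelief (K := K) (fun n i s => PowerSeries.coeff (i : ℕ) (p n s)) n k so := by
  simp_rw [ubelief_eq_coeff_prod hk]
  rw [← map_sum, ← Fintype.piFinset_univ, ← Finset.prod_univ_sum]
  simp_rw [hp]
  rw [prod_const, card_univ, Fintype.card_subtype_compl, Fintype.card_fin,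
    Fintype.card_subtype_eq]
  obtain ⟨e, rfl⟩ := Nat.exists_eq_add_of_le' hN
  rw [show e + 2 - 1 = e + 1 by omega, PowerSeries.mk_one_pow_eq_mk_choose_add]
  simp only [PowerSeries.coeff_mk, Nat.cast_pos]
  exact Nat.choose_pos (Nat.le_add_right _ _)

theorem beliefPayoff_belief_eq {K k : ℕ} (hk : k ≤ K) (p : ∀ n, S n → PowerSeries ℝ)
    (G : Fin N → (∀ m, S m) → ℝ) (n : Fin N) (τn : S n → ℝ) :
    beliefPayoff G n τn (belief (K := K) (fun n i s => PowerSeries.coeff (i : ℕ) (p n s)) n k)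
      = (∑ so, ubelief (K := K) (fun n i s => PowerSeries.coeff (i : ℕ) (p n s)) n k so)⁻¹ *
        PowerSeries.coeff k (∑ so : ∀ m : {m : Fin N // m ≠ n}, S m.val,
          PowerSeries.C (∑ t, τn t * G n (combine n t so)) *
            ∏ m : {m : Fin N // m ≠ n}, p m (so m)) := by
  rw [beliefPayoff, map_sum, mul_sum]
  refine sum_congr rfl fun so _ => ?_
  rw [PowerSeries.coeff_C_mul, sum_mul, mul_sum, belief, ubelief_eq_coeff_prod hk]
  exact sum_congr rfl fun t _ => by ring

variable [∀ n, DecidableEq (S n)]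

/-- The payoff that player `n` loses by deviating from `σ n` to `sn`
when the opponents play `so`. -/
noncomputable def deviationLoss (G : Fin N → (∀ m, S m) → ℝ) (σ : Profile S) (n : Fin N) (sn : S n)
    (so : ∀ m : {m : Fin N // m ≠ n}, S m.val) : ℝ :=
  ∑ t, (σ n t - pureStrat sn t) * G n (combine n t so)

/-- The loss of player `n` from deviating from `σ n` to `sn` against a profile of power series. -/
noncomputable def lossSeries (G : Fin N → (∀ m, S m) → ℝ) (σ : Profile S) (n : Fin N) (sn : S n)
    (p : ∀ n, S n → PowerSeries ℝ) : PowerSeries ℝ :=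
  ∑ so : ∀ m : {m : Fin N // m ≠ n}, S m.val, PowerSeries.C (deviationLoss G σ n sn so) *
    ∏ m : {m : Fin N // m ≠ n}, p m (so m)

theorem lossSeries_mul (G : Fin N → (∀ m, S m) → ℝ) (σ : Profile S) (n : Fin N) (sn : S n)
    (p : ∀ n, S n → PowerSeries ℝ) (w : Fin N → PowerSeries ℝ) :
    lossSeries G σ n sn (fun m s => p m s * w m)
      = lossSeries G σ n sn p * ∏ m : {m : Fin N // m ≠ n}, w m := by
  simp only [lossSeries, prod_mul_distrib, sum_mul, mul_assoc]

theorem lossSeries_rescale (G : Fin N → (∀ m, S m) → ℝ) (σ : Profile S) (n : Fin N) (sn : S n)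
    (p : ∀ n, S n → PowerSeries ℝ) (c : ℝ) :
    lossSeries G σ n sn (fun m s => PowerSeries.rescale c (p m s))
      = PowerSeries.rescale c (lossSeries G σ n sn p) := by
  simp only [lossSeries, map_sum, map_mul, map_prod, rescale_C]

theorem lpsBestReply_of_lossSeries {K : ℕ} (hN : 2 ≤ N) (G : Fin N → (∀ m, S m) → ℝ)
    (σ : Profile S) (p : ∀ n, S n → PowerSeries ℝ) (hp : ∀ n, ∑ s, p n s = PowerSeries.mk 1)
    (n : Fin N)
    (h : ∀ sn, lossSeries G σ n sn p = 0 ∨ ∃ m, PosLead (lossSeries G σ n sn p) m) :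
    lpsBestReply G (K := K) (fun n i s => PowerSeries.coeff (i : ℕ) (p n s)) n (σ n) K := by
  intro sn
  have key : ∀ i ≤ K, ∃ c > 0,
      beliefPayoff G n (σ n)
          (belief (K := K) (fun n i s => PowerSeries.coeff (i : ℕ) (p n s)) n i)
        - beliefPayoff G n (pureStrat sn)
          (belief (K := K) (fun n i s => PowerSeries.coeff (i : ℕ) (p n s)) n i)
        = c * PowerSeries.coeff i (lossSeries G σ n sn p) := fun i hi => by
    refine ⟨_, inv_pos.2 (sum_ubelief_pos hN hi p hp n), ?_⟩
    rw [beliefPayoff_belief_eq hi, beliefPayoff_belief_eq hi, ← mul_sub, ← map_sub,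
      ← sum_sub_distrib]
    simp only [lossSeries, deviationLoss, ← sub_mul, ← map_sub, ← sum_sub_distrib]
  have hzero : ∀ i ≤ K, PowerSeries.coeff i (lossSeries G σ n sn p) = 0 →
      beliefPayoff G n (σ n)
          (belief (K := K) (fun n i s => PowerSeries.coeff (i : ℕ) (p n s)) n i)
        = beliefPayoff G n (pureStrat sn)
          (belief (K := K) (fun n i s => PowerSeries.coeff (i : ℕ) (p n s)) n i) :=
    fun i hi h0 => by
      obtain ⟨c, -, hc⟩ := key i hi
      rw [h0, mul_zero] at hc
      exact sub_eq_zero.1 hc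
  rcases h sn with h | ⟨m, hm⟩
  · exact Or.inl fun i hi => hzero i hi (by rw [h, map_zero])
  · rcases le_or_gt m K with hmK | hmK
    · refine Or.inr ⟨m, hmK, fun j hj => hzero j (by omega) (hm.1 j hj), ?_⟩
      obtain ⟨c, hc0, hc⟩ := key m hmK
      exact sub_pos.1 (hc ▸ mul_pos hc0 hm.2)
    · exact Or.inl fun i hi => hzero i hi (hm.1 i (by omega))

end Games

section Perfect

variable {S : Fin N → Type} [∀ n, Fintype (S n)] [∀ n, DecidableEq (S n)]

theorem IsPerfect.exists_curve {G : Fin N → (∀ m, S m) → ℝ} {σ : Profile S} (hN : 2 ≤ N)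
    (halgG : ∀ n (s : ∀ m, S m), IsAlgebraic ℚ (G n s)) (hσ : IsMixed σ)
    (halgσ : ∀ n (sn : S n), IsAlgebraic ℚ (σ n sn)) (hperf : IsPerfect G σ) :
    ∃ b : ∀ n, S n → PowerSeries ℝ,
      (∀ n s i, IsAlgebraic ℚ (PowerSeries.coeff i (b n s))) ∧
      (∀ n s, PowerSeries.coeff 0 (b n s) = σ n s) ∧
      (∀ n, ∑ s, b n s = 1) ∧
      (∀ n s, ∃ m ≤ 8 * (4 * (N - 1) + 1) ^ (2 * ∑ n, Fintype.card (S n)), PosLead (b n s) m) ∧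
      ∀ n sn, lossSeries G σ n sn b = 0 ∨ ∃ m, PosLead (lossSeries G σ n sn b) m := by
  obtain ⟨σk, hmix, hlim, hbest⟩ := hperf
  let F := algebraicClosure ℚ ℝ
  have : Algebra.IsAlgebraic ℚ F := algebraicClosure.isAlgebraic ℚ ℝ
  have hF : ∀ r : ℝ, IsAlgebraic ℚ r → r ∈ F := fun r h => mem_algebraicClosure_iff.2 h
  have hcl : ∀ r : ℝ, IsAlgebraic F r → ∃ c : F, algebraMap F ℝ c = r := fun r hr =>
    ⟨⟨r, hF r (hr.restrictScalars ℚ)⟩, rfl⟩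
  have hloss : ∀ n sn so, deviationLoss G σ n sn so ∈ F := fun n sn so => by
    refine sum_mem fun t _ => mul_mem (sub_mem (hF _ (halgσ n t)) ?_) (hF _ (halgG _ _))
    rw [pureStrat]
    split_ifs
    exacts [one_mem _, zero_mem _]
  let g : (Σ n, S n) → MvPolynomial (Σ n, S n) F := fun q =>
    ∑ so : ∀ m : {m : Fin N // m ≠ q.1}, S m.val,
      MvPolynomial.C ⟨deviationLoss G σ q.1 q.2 so, hloss _ _ _⟩ *
        ∏ m : {m : Fin N // m ≠ q.1}, MvPolynomial.X ⟨m, so m⟩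
  have hgdeg : ∀ q, (g q).totalDegree ≤ N - 1 := fun q => by
    refine MvPolynomial.totalDegree_finsetSum_le fun so _ => ?_
    refine (MvPolynomial.totalDegree_mul _ _).trans ?_
    rw [MvPolynomial.totalDegree_C, zero_add]
    refine (MvPolynomial.totalDegree_finsetProd _ _).trans ?_
    simp [MvPolynomial.totalDegree_X, Fintype.card_subtype_compl]
  obtain ⟨a, ha0, hapos, hag⟩ := exists_powerSeries_curve hcl (d := N - 1) (by omega) g hgdeg
    (fun q => ⟨σ q.1 q.2, hF _ (halgσ _ _)⟩) (fun j q => σk j q.1 q.2)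
    (fun j q => (hmix j).2 q.1 q.2)
    (fun j q => by
      have h := sub_nonneg.2 (hbest j q.1 q.2)
      rw [payoff_update, payoff_update, ← sum_sub_distrib] at h
      convert h using 1
      simp only [g, map_sum, map_mul, map_prod, MvPolynomial.aeval_X, MvPolynomial.aeval_C]
      refine sum_congr rfl fun so _ => ?_
      rw [← sub_mul, ← sum_sub_distrib]
      simp only [← sub_mul]
      rfl)
    (tendsto_pi_nhds.2 fun q => tendsto_pi_nhds.1 (tendsto_pi_nhds.1 hlim q.1) q.2)
  let u : Fin N → PowerSeries F := fun n => ∑ s, a ⟨n, s⟩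
  have hu0 : ∀ n, PowerSeries.constantCoeff (u n) = 1 := fun n => by
    rw [← PowerSeries.coeff_zero_eq_constantCoeff_apply, map_sum]
    simp only [ha0]
    refine (algebraMap F ℝ).injective ?_
    rw [map_sum, map_one]
    exact (hσ n).2
  let w : Fin N → PowerSeries ℝ := fun n => PowerSeries.map (algebraMap F ℝ) (u n)⁻¹
  have hw0 : ∀ n, PowerSeries.constantCoeff (w n) = 1 := fun n => by
    simp only [w]
    rw [← PowerSeries.coeff_zero_eq_constantCoeff_apply, PowerSeries.coeff_map,
      PowerSeries.coeff_zero_eq_constantCoeff_apply, PowerSeries.constantCoeff_inv, hu0, inv_one,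
      map_one]
  let A : ∀ n, S n → PowerSeries ℝ := fun n s => PowerSeries.map (algebraMap F ℝ) (a ⟨n, s⟩)
  have hA : ∀ n s, ∃ m ≤ 8 * (4 * (N - 1) + 1) ^ (2 * ∑ n, Fintype.card (S n)),
      PosLead (A n s) m := fun n s => by
    obtain ⟨m, hm, h0, h1⟩ := hapos ⟨n, s⟩
    refine ⟨m, ?_, fun j hj => ?_, ?_⟩
    · rwa [← two_mul, Fintype.card_sigma] at hm
    · simp only [A, PowerSeries.coeff_map, h0 j hj, map_zero]
    · simpa only [A, PowerSeries.coeff_map] using h1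
  have hLA : ∀ n sn, lossSeries G σ n sn A
      = PowerSeries.map (algebraMap F ℝ) (MvPolynomial.aeval a (g ⟨n, sn⟩)) := fun n sn => by
    simp only [g, lossSeries, A, map_sum, map_mul, map_prod, MvPolynomial.aeval_X,
      MvPolynomial.aeval_C]
    refine sum_congr rfl fun so _ => ?_
    congr 1
    rw [PowerSeries.algebraMap_apply, PowerSeries.map_C]
    rfl
  refine ⟨fun n s => A n s * w n, fun n s i => ?_, fun n s => ?_, fun n => ?_, fun n s => ?_,
    fun n sn => ?_⟩
  · simp only [A, w]
    rw [← map_mul, PowerSeries.coeff_map]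
    exact mem_algebraicClosure_iff.1 (SetLike.coe_mem _)
  · rw [PowerSeries.coeff_zero_eq_constantCoeff_apply, map_mul, hw0, mul_one,
      ← PowerSeries.coeff_zero_eq_constantCoeff_apply, PowerSeries.coeff_map, ha0]
    rfl
  · rw [← sum_mul, ← map_sum, ← map_mul, PowerSeries.mul_inv_cancel, map_one]
    rw [hu0]
    exact one_ne_zero
  · obtain ⟨m, hm, h⟩ := hA n s
    exact ⟨m, hm, h.mul (by rw [hw0]; exact one_pos)⟩
  · rw [lossSeries_mul, hLA]
    rcases hag ⟨n, sn⟩ with h | ⟨m, h0, h1⟩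
    · exact Or.inl (by rw [h, map_zero, zero_mul])
    · refine Or.inr ⟨m, PosLead.mul ⟨fun j hj => ?_, ?_⟩ ?_⟩
      · rw [PowerSeries.coeff_map, h0 j hj, map_zero]
      · rwa [PowerSeries.coeff_map]
      · rw [map_prod]
        simp only [hw0, prod_const_one, zero_lt_one]

theorem IsPerfect.exists_algebraic_lps {G : Fin N → (∀ m, S m) → ℝ} {σ : Profile S} (hN : 2 ≤ N)
    (halgG : ∀ n (s : ∀ m, S m), IsAlgebraic ℚ (G n s)) (hσ : IsMixed σ)
    (halgσ : ∀ n (sn : S n), IsAlgebraic ℚ (σ n sn)) (hperf : IsPerfect G σ) {l K : ℕ}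
    (hl : 8 * (4 * (N - 1) + 1) ^ (2 * ∑ n, Fintype.card (S n)) ≤ l) (hlK : l ≤ K) :
    ∃ ϱ : ∀ n, Fin (K + 1) → S n → ℝ,
      (∀ n k (sn : S n), IsAlgebraic ℚ (ϱ n k sn)) ∧
      (IsLPSProfile ϱ ∧ FullSupport ϱ ∧ lpsLevel ϱ ≤ l) ∧
      (∀ n, ϱ n 0 = σ n) ∧
      (∀ n, lpsBestReply G ϱ n (σ n) K) := by
  obtain ⟨b, hbalg, hb0, hbsum, hblead, hbloss⟩ := hperf.exists_curve hN halgG hσ halgσ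
  have hc : ∀ᶠ c in 𝓝[>] (0 : ℝ), ∀ n, ∀ s : S n, ∀ k : Fin (K + 1),
      0 ≤ ∑ i ∈ range ((k : ℕ) + 1), c ^ i * PowerSeries.coeff i (b n s) :=
    eventually_all.2 fun n => eventually_all.2 fun s => eventually_all.2 fun k => by
      obtain ⟨m, -, h⟩ := hblead n s
      exact h.eventually_partialSum_nonneg k
  obtain ⟨M, hM, hMpos⟩ := (((tendsto_inv_atTop_nhdsGT_zero.comp
    tendsto_natCast_atTop_atTop).eventually hc).and (eventually_gt_atTop 0)).exists
  simp only [Function.comp_apply] at hM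
  have hcpos : (0 : ℝ) < (M : ℝ)⁻¹ := inv_pos.2 (Nat.cast_pos.2 hMpos)
  let p : ∀ n, S n → PowerSeries ℝ := fun n s =>
    PowerSeries.rescale (M : ℝ)⁻¹ (b n s) * PowerSeries.mk 1
  have hpcoeff : ∀ n s k, PowerSeries.coeff k (p n s)
      = ∑ i ∈ range (k + 1), (M : ℝ)⁻¹ ^ i * PowerSeries.coeff i (b n s) := fun n s k => by
    simp only [p, coeff_mul_mk_one, PowerSeries.coeff_rescale]
  have hpsum : ∀ n, ∑ s, p n s = PowerSeries.mk 1 := fun n => by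
    simp only [p]
    rw [← sum_mul, ← map_sum, hbsum, map_one, one_mul]
  have hsupp : ∀ n s, ∃ i : Fin (K + 1), (i : ℕ) ≤ l ∧ PowerSeries.coeff (i : ℕ) (p n s) ≠ 0 :=
    fun n s => by
      obtain ⟨m, hm, h⟩ := hblead n s
      exact ⟨⟨m, by omega⟩, hm.trans hl, h.coeff_rescale_mul_mk_one_ne_zero hcpos⟩
  refine ⟨fun n k s => PowerSeries.coeff (k : ℕ) (p n s), fun n k s => ?_,
    ⟨fun n k => ⟨fun s => ?_, ?_⟩, fun n s => ?_, Finset.sup_le fun n _ => Nat.sInf_le (hsupp n)⟩,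
    fun n => funext fun s => ?_, fun n => lpsBestReply_of_lossSeries hN G σ p hpsum n fun sn => ?_⟩
  · simp only [hpcoeff]
    refine mem_algebraicClosure_iff.1 (sum_mem fun i _ => mul_mem (pow_mem (inv_mem ?_) i)
      (mem_algebraicClosure_iff.2 (hbalg n s i)))
    exact natCast_mem _ M
  · simp only [hpcoeff]
    exact hM n s k
  · simp only
    rw [← map_sum, hpsum, PowerSeries.coeff_mk, Pi.one_apply]
  · obtain ⟨i, -, hi⟩ := hsupp n s
    exact ⟨i, hi⟩
  · simp only [hpcoeff, Fin.val_zero, zero_add, range_one, sum_singleton, pow_zero, one_mul, hb0]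
  · simp only [p]
    rw [lossSeries_mul (p := fun n s => PowerSeries.rescale (M : ℝ)⁻¹ (b n s))
      (w := fun _ => PowerSeries.mk 1), lossSeries_rescale]
    rcases hbloss n sn with h | ⟨m, h⟩
    · exact Or.inl (by rw [h, map_zero, zero_mul])
    · exact Or.inr ⟨m, (h.rescale hcpos).mul (by simp)⟩

theorem order_bound_le {κ d Z D : ℕ} (hκ : 1 ≤ κ) (hd : 1 ≤ d)
    (hZ : Z = (2 * d + 6) * (2 * d + 5) ^ (κ - 1)) (hD : D = 5 * (κ * (2 * d + 4) + 2) * Z) :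
    8 * (4 * d + 1) ^ (2 * κ) ≤ 2 * d * (Z * D) ^ 2 * (1 + Z) := by
  have hZ1 : (2 * d + 5) ^ κ ≤ Z := by
    obtain ⟨e, rfl⟩ := Nat.exists_eq_add_of_le' hκ
    rw [hZ, Nat.add_sub_cancel, pow_succ, mul_comm]
    exact Nat.mul_le_mul_right _ (by omega)
  have hZ2 : (4 * d + 1) ^ (2 * κ) ≤ Z ^ 4 :=
    calc (4 * d + 1) ^ (2 * κ) ≤ ((2 * d + 5) ^ 2) ^ (2 * κ) := Nat.pow_le_pow_left (by nlinarith) _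
      _ = ((2 * d + 5) ^ κ) ^ 4 := by rw [← pow_mul, ← pow_mul]; ring_nf
      _ ≤ _ := Nat.pow_le_pow_left hZ1 4
  have hD1 : 10 * Z ≤ D := by
    rw [hD]
    exact Nat.mul_le_mul_right _ (by omega)
  calc 8 * (4 * d + 1) ^ (2 * κ) ≤ 2 * 1 * (Z * (10 * Z)) ^ 2 * 1 := by nlinarith
    _ ≤ _ := by gcongr; omega

end Perfect

end CurveSelection

/-- for games with algebraic payoffs, a perfect equilibrium with algebraic
coordinates admits a certifying LPS profile all of whose probabilities are algebraic. -/
theorem stmt13 {N : ℕ} (hN : 2 ≤ N) (S : Fin N → Type) [∀ n, Fintype (S n)]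
    [∀ n, DecidableEq (S n)] [∀ n, Nonempty (S n)]
    (G : Fin N → (∀ m, S m) → ℝ)
    (halgG : ∀ n (s : ∀ m, S m), IsAlgebraic ℚ (G n s))
    (κ d Z D L : ℕ)
    (hκ : κ = ∑ n, Fintype.card (S n)) (hd : d = N - 1)
    (hZ : Z = (2*d+6)*(2*d+5)^(κ-1)) (hD : D = 5*(κ*(2*d+4)+2)*Z)
    (hL : L = d*(6*d-3)^(2*κ-1))
    (ℓ K : ℕ) (hℓ : ℓ = 2*d*(Z*D)^2*(1+Z)) (hK : K = L*ℓ)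
    (σ : Profile S) (hσ : IsMixed σ)
    (halgσ : ∀ n (sn : S n), IsAlgebraic ℚ (σ n sn))
    (hperf : IsPerfect G σ) :
    ∃ ϱ : ∀ n, Fin (K+1) → S n → ℝ,
      (∀ n k (sn : S n), IsAlgebraic ℚ (ϱ n k sn)) ∧
      (IsLPSProfile ϱ ∧ FullSupport ϱ ∧ lpsLevel ϱ ≤ ℓ) ∧
      (∀ n, ϱ n 0 = σ n) ∧
      (∀ n, lpsBestReply G ϱ n (σ n) K) := by
  have hd1 : 1 ≤ d := by omega
  have hκ1 : 1 ≤ κ := by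
    rw [hκ]
    exact (Fintype.card_pos (α := S ⟨0, by omega⟩)).trans_le
      (Finset.single_le_sum (f := fun n => Fintype.card (S n)) (fun _ _ => Nat.zero_le _)
        (Finset.mem_univ _))
  have hL1 : 1 ≤ L := by
    rw [hL]
    exact Nat.mul_pos hd1 (pow_pos (by omega) _)
  refine hperf.exists_algebraic_lps hN halgG hσ halgσ ?_ ?_
  · rw [← hd, ← hκ, hℓ]
    exact order_bound_le hκ1 hd1 hZ hD
  · rw [hK]
    exact Nat.le_mul_of_pos_left ℓ hL1

end GamePE
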